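/- arXiv:2006.08040 — 2 statements merged into one kernel-verified Lean document; each statement's English description precedes it below -/
import Mathlib

section
/- Lemma 2.1 (regret of log-barrier OMD with increasing learning rates, MAB): For any u in the clipped simplex Ω, Algorithm 1 guarantees deterministically, for every realization of the losses and the sampled arms, Σ_{t=1}^T (ℓ_{t,i_t} − ⟨u, ℓ̂_t⟩) ≤ O(d ln T / η + η Σ_{t=1}^T ℓ_{t,i_t}) − ⟨ρ_T, u⟩/(10 η ln T), where ρ_T = (ρ_{T,1},…,ρ_{T,d}) is the final vector of thresholds maintained by the algorithm. -/
open Real Finset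

/-- the scalar log-barrier divergence -/
noncomputable def hh (x : ℝ) : ℝ := x - 1 - Real.log x

lemma hh_nonneg {x : ℝ} (hx : 0 < x) : 0 ≤ hh x := by
  unfold hh
  have := Real.log_le_sub_one_of_pos hx
  linarith

lemma stab {a x : ℝ} (ha : 0 ≤ a) (hx : 0 < x) : (1 - x) * a ≤ hh x + a ^ 2 := by
  have h1 : 0 < 1 + a := by linarith
  have h2 := Real.log_le_sub_one_of_pos (mul_pos hx h1)
  rw [Real.log_mul hx.ne' h1.ne'] at h2
  have h3 := Real.one_sub_inv_le_log_of_pos h1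
  have h4 : (1 + a)⁻¹ ≤ 1 - a + a ^ 2 := by
    rw [inv_le_iff_one_le_mul₀ h1]
    nlinarith [pow_nonneg ha 3]
  unfold hh
  nlinarith

lemma first_order {d : ℕ} (w w' u b m : Fin d → ℝ)
    (hw : ∀ i, 0 < w i) (hw' : ∀ i, 0 < w' i) (hu : ∀ i, 0 < u i) (hb : ∀ i, 0 < b i)
    (hmin : ∀ s : ℝ, 0 < s → s < 1 →
      (∑ i, w' i * m i) + ∑ i, b i * hh (w' i / w i)
        ≤ (∑ i, (w' i + s * (u i - w' i)) * m i)
          + ∑ i, b i * hh ((w' i + s * (u i - w' i)) / w i)) :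
    0 ≤ ∑ i, ((u i - w' i) * m i + b i * ((u i - w' i) / w i - (u i - w' i) / w' i)) := by
  let G : ℝ → ℝ := fun s => ∑ i, ((u i - w' i) * m i
    + b i * ((u i - w' i) / w i - (u i - w' i) / (w' i + s * (u i - w' i))))
  have hG : ContinuousAt G 0 := by
    apply tendsto_finsetSum
    intro i _
    have : w' i + 0 * (u i - w' i) ≠ 0 := by simpa using (hw' i).ne'
    change ContinuousAt (fun s : ℝ => (u i - w' i) * m i
      + b i * ((u i - w' i) / w i - (u i - w' i) / (w' i + s * (u i - w' i)))) 0
    fun_prop (disch := assumption)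
  have hG0 : G 0 = ∑ i, ((u i - w' i) * m i
      + b i * ((u i - w' i) / w i - (u i - w' i) / w' i)) := by
    simp [G]
  rw [← hG0]
  have ht : Filter.Tendsto G (nhdsWithin 0 (Set.Ioi 0)) (nhds (G 0)) :=
    hG.tendsto.mono_left nhdsWithin_le_nhds
  refine ge_of_tendsto ht ?_
  filter_upwards [Ioo_mem_nhdsGT (show (0 : ℝ) < 1 by norm_num)] with s hs
  obtain ⟨hs0, hs1⟩ := hs
  have h := hmin s hs0 hs1
  have key : (∑ i, (w' i + s * (u i - w' i)) * m i)
          + ∑ i, b i * hh ((w' i + s * (u i - w' i)) / w i)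
          ≤ ((∑ i, w' i * m i) + ∑ i, b i * hh (w' i / w i)) + s * G s := by
    simp only [G]
    rw [Finset.mul_sum, ← Finset.sum_add_distrib, ← Finset.sum_add_distrib,
      ← Finset.sum_add_distrib]
    apply Finset.sum_le_sum
    intro i _
    have hv : 0 < w' i + s * (u i - w' i) := by
      nlinarith [mul_pos hs0 (hu i), mul_pos (sub_pos.2 hs1) (hw' i)]
    set v := w' i + s * (u i - w' i) with hvdef
    have hl : hh (v / w i) ≤ hh (w' i / w i) + s * ((u i - w' i) / w i - (u i - w' i) / v) := by
      unfold hh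
      rw [Real.log_div hv.ne' (hw i).ne', Real.log_div (hw' i).ne' (hw i).ne']
      have h1 := Real.log_le_sub_one_of_pos (div_pos (hw' i) hv)
      rw [Real.log_div (hw' i).ne' hv.ne'] at h1
      have e1 : v / w i = w' i / w i + s * ((u i - w' i) / w i) := by
        rw [hvdef]; ring
      have e2 : w' i / v = 1 - s * ((u i - w' i) / v) := by
        field_simp
        rw [hvdef]; ring
      rw [e1]; rw [e2] at h1
      linarith
    have := mul_le_mul_of_nonneg_left hl (hb i).le
    have e3 : v * m i = w' i * m i + s * ((u i - w' i) * m i) := by rw [hvdef]; ring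
    rw [e3]
    linarith
  have : 0 ≤ s * G s := by linarith
  exact nonneg_of_mul_nonneg_right this hs0

lemma three_pt {u w w' : ℝ} (hu : 0 < u) (hw : 0 < w) (hw' : 0 < w') :
    (u - w') / w - (u - w') / w' = hh (u / w) - hh (u / w') - hh (w' / w) := by
  unfold hh
  rw [Real.log_div hu.ne' hw.ne', Real.log_div hu.ne' hw'.ne', Real.log_div hw'.ne' hw.ne']
  field_simp
  ring

/-- one step of OMD -/
lemma one_step {d : ℕ} (w w' u e l : Fin d → ℝ) (j : Fin d)
    (hw : ∀ i, 0 < w i) (hw' : ∀ i, 0 < w' i) (hu : ∀ i, 0 < u i) (he : ∀ i, 0 < e i)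
    (hl : l j ∈ Set.Icc (0 : ℝ) 1)
    (hmin : ∀ s : ℝ, 0 < s → s < 1 →
      (∑ i, w' i * (if j = i then l i / w i else 0)) + ∑ i, (1 / e i) * hh (w' i / w i)
        ≤ (∑ i, (w' i + s * (u i - w' i)) * (if j = i then l i / w i else 0))
          + ∑ i, (1 / e i) * hh ((w' i + s * (u i - w' i)) / w i)) :
    l j - ∑ i, u i * (if j = i then l i / w i else 0)
      ≤ e j * l j + ∑ i, (1 / e i) * (hh (u i / w i) - hh (u i / w' i)) := by
  have h := first_order w w' u (fun i => 1 / e i) (fun i => if j = i then l i / w i else 0)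
    hw hw' hu (fun i => one_div_pos.2 (he i)) hmin
  have h2 : ∑ i, ((u i - w' i) * (if j = i then l i / w i else 0)
      + 1 / e i * ((u i - w' i) / w i - (u i - w' i) / w' i))
      = ∑ i, u i * (if j = i then l i / w i else 0)
       + ∑ i, (1 / e i) * (hh (u i / w i) - hh (u i / w' i))
       - ((∑ i, w' i * (if j = i then l i / w i else 0)) + ∑ i, (1 / e i) * hh (w' i / w i)) := by
    rw [← Finset.sum_add_distrib, ← Finset.sum_add_distrib, ← Finset.sum_sub_distrib]
    apply Finset.sum_congr rfl
    intro i _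
    rw [three_pt (hu i) (hw i) (hw' i)]
    ring
  rw [h2] at h
  have h3 : (∑ i, w' i * (if j = i then l i / w i else 0)) = w' j * (l j / w j) := by
    simp
  have h4 : (1 / e j) * hh (w' j / w j) ≤ ∑ i, (1 / e i) * hh (w' i / w i) :=
    Finset.single_le_sum (f := fun i => (1 / e i) * hh (w' i / w i))
      (fun i _ => mul_nonneg (one_div_pos.2 (he i)).le (hh_nonneg (div_pos (hw' i) (hw i))))
      (Finset.mem_univ j)
  have h5 := stab (mul_nonneg (he j).le hl.1) (div_pos (hw' j) (hw j))
  have h6 : l j - w' j * (l j / w j) ≤ (1 / e j) * hh (w' j / w j) + e j * l j := by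
    have e1 : l j - w' j * (l j / w j) = (1 / e j) * ((1 - w' j / w j) * (e j * l j)) := by
      have := (he j).ne'
      field_simp
    rw [e1]
    have h7 := mul_le_mul_of_nonneg_left h5 (one_div_pos.2 (he j)).le
    have e2 : (1 / e j) * (hh (w' j / w j) + (e j * l j) ^ 2)
        = (1 / e j) * hh (w' j / w j) + e j * (l j * l j) := by
      have := (he j).ne'
      field_simp
    rw [e2] at h7
    have h8 : l j * l j ≤ l j := by nlinarith [hl.1, hl.2]
    have h9 := mul_le_mul_of_nonneg_left h8 (he j).le
    linarith
  rw [h3] at h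
  linarith

lemma exp_bound {L k : ℝ} (hL : 0 < L) (hk : k * Real.log 2 ≤ L) : Real.exp (k / L) ≤ 5 := by
  have hl2 := Real.log_two_gt_d9
  have h1 : k / L ≤ 3 / 2 := by
    rw [div_le_iff₀ hL]
    by_cases hk0 : 0 ≤ k
    · nlinarith
    · nlinarith
  have h2 : Real.exp (3 / 2) ≤ 5 := by
    have h3 : Real.exp (3 / 2) ^ 2 = Real.exp 1 ^ 3 := by
      rw [← Real.exp_nat_mul, ← Real.exp_nat_mul]; norm_num
    have h4 : Real.exp 1 ^ 3 ≤ 2.72 ^ 3 := by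
      have := Real.exp_one_lt_d9
      gcongr
      linarith
    nlinarith [Real.exp_pos (3 / 2)]
  exact (Real.exp_le_exp.2 h1).trans h2

/-- scalar bookkeeping of learning rates -/
lemma rates (d T : ℕ) (η : ℝ) (w e r : ℕ → ℝ) (hd : 1 ≤ d) (hT : 2 ≤ T)
    (hw1 : w 1 = 1 / (d : ℝ)) (he1 : e 1 = η) (hr1 : r 1 = 2 * d)
    (hw : ∀ t ∈ Finset.Icc 1 (T + 1), 1 / (T : ℝ) ≤ w t)
    (hupd : ∀ t ∈ Finset.Icc 1 T,
      (1 / w (t + 1) > r t → r (t + 1) = 2 / w (t + 1) ∧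
        e (t + 1) = Real.exp (1 / Real.log T) * e t) ∧
      (¬ (1 / w (t + 1) > r t) → r (t + 1) = r t ∧ e (t + 1) = e t))
    (n : ℕ) (hn1 : 1 ≤ n) (hn : n ≤ T) :
    ∃ k : ℕ, e n = Real.exp (k / Real.log T) * η ∧ (2 : ℝ) ^ (k + 1) ≤ r n ∧ r n ≤ 2 * T := by
  have hTpos : (0 : ℝ) < T := by positivity
  have hdpos : (0 : ℝ) < d := by exact_mod_cast hd
  induction n, hn1 using Nat.le_induction with
  | base =>
    refine ⟨0, by simp [he1], ?_, ?_⟩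
    · rw [hr1]; have : (1 : ℝ) ≤ d := by exact_mod_cast hd
      norm_num; linarith
    · have := hw 1 (by simp)
      rw [hw1] at this
      have := (one_div_le_one_div hTpos hdpos).1 this
      rw [hr1]; linarith
  | succ n hn1 ih =>
    obtain ⟨k, h1, h2, h3⟩ := ih (by omega)
    have hu := hupd n (by simp; omega)
    by_cases hc : 1 / w (n + 1) > r n
    · obtain ⟨a, b⟩ := hu.1 hc
      refine ⟨k + 1, ?_, ?_, ?_⟩
      · rw [b, h1, ← mul_assoc, ← Real.exp_add]
        push_cast
        congr 2
        ring
      · rw [a, pow_succ]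
        have : 2 / w (n + 1) = (1 / w (n + 1)) * 2 := by ring
        rw [this]
        nlinarith
      · rw [a]
        have h5 := hw (n + 1) (by simp; omega)
        have h6 := one_div_le_one_div_of_le (by positivity) h5
        rw [one_div_one_div] at h6
        have : 2 / w (n + 1) = (1 / w (n + 1)) * 2 := by ring
        linarith
    · obtain ⟨a, b⟩ := hu.2 hc
      exact ⟨k, by rw [b, h1], by rw [a]; exact h2, by rw [a]; exact h3⟩

lemma rate_bd {T : ℕ} {η e r : ℝ} (hT : 2 ≤ T) (hη : 0 < η)
    (h : ∃ k : ℕ, e = Real.exp (k / Real.log T) * η ∧ (2 : ℝ) ^ (k + 1) ≤ r ∧ r ≤ 2 * T) :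
    0 < e ∧ e ≤ 5 * η ∧ 0 < r ∧ r ≤ 2 * T := by
  obtain ⟨k, h1, h2, h3⟩ := h
  have hL : 0 < Real.log T := Real.log_pos (by exact_mod_cast hT)
  refine ⟨by rw [h1]; positivity, ?_, lt_of_lt_of_le (by positivity) h2, h3⟩
  rw [h1]
  refine mul_le_mul_of_nonneg_right (exp_bound hL ?_) hη.le
  have : (2 : ℝ) ^ k ≤ T := by rw [pow_succ] at h2; linarith
  have := Real.log_le_log (by positivity) this
  rwa [Real.log_pow] at this

/-- gain from one increase of the learning rate -/
lemma gain {η L e x κ : ℝ} (hη : 0 < η) (hL : Real.log 2 ≤ L) (hκ : κ = Real.exp (1 / L))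
    (he : 0 < e) (hb : κ * e ≤ 5 * η) (hx : 0 < x) (hxL : Real.log x ≤ L) :
    (1 / (κ * e) - 1 / e) * hh x ≤ L / η - 2 * x / (10 * η * L) := by
  have hl2 := Real.log_two_gt_d9
  have hLpos : 0 < L := by linarith
  have hκ1 : 1 + 1 / L ≤ κ := by rw [hκ]; linarith [Real.add_one_le_exp (1 / L)]
  have hκpos : 0 < κ := by rw [hκ]; positivity
  have h1 : 1 / (κ * e) - 1 / e ≤ - (1 / (5 * η * L)) := by
    have e1 : 1 / (κ * e) - 1 / e = - ((κ - 1) * (1 / (κ * e))) := by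
      field_simp; ring
    rw [e1]
    have h2 : 1 / (5 * η) ≤ 1 / (κ * e) := one_div_le_one_div_of_le (by positivity) hb
    have h3 : (1 / L) * (1 / (5 * η)) ≤ (κ - 1) * (1 / (κ * e)) :=
      mul_le_mul (by linarith) h2 (by positivity) (by linarith [one_div_pos.2 hLpos])
    have e2 : (1 / L) * (1 / (5 * η)) = 1 / (5 * η * L) := by field_simp
    linarith
  have h2 := mul_le_mul_of_nonneg_right h1 (hh_nonneg hx)
  refine h2.trans ?_
  unfold hh
  have e1 : L / η - 2 * x / (10 * η * L) - -(1 / (5 * η * L)) * (x - 1 - Real.log x)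
      = (5 * L ^ 2 - 1 - Real.log x) / (5 * η * L) := by
    field_simp; ring
  have : 0 ≤ (5 * L ^ 2 - 1 - Real.log x) / (5 * η * L) := by
    apply div_nonneg _ (by positivity)
    nlinarith
  linarith

/-- scalar telescoping -/
lemma coord (d T : ℕ) (η u : ℝ) (w e r : ℕ → ℝ) (hd : 1 ≤ d) (hT : 2 ≤ T) (hη : 0 < η)
    (hu : 0 < u) (hu1 : u ≤ 1)
    (hw1 : w 1 = 1 / (d : ℝ)) (he1 : e 1 = η) (hr1 : r 1 = 2 * d)
    (hw : ∀ t ∈ Finset.Icc 1 (T + 1), 1 / (T : ℝ) ≤ w t)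
    (hupd : ∀ t ∈ Finset.Icc 1 T,
      (1 / w (t + 1) > r t → r (t + 1) = 2 / w (t + 1) ∧
        e (t + 1) = Real.exp (1 / Real.log T) * e t) ∧
      (¬ (1 / w (t + 1) > r t) → r (t + 1) = r t ∧ e (t + 1) = e t))
    (n : ℕ) (hn1 : 1 ≤ n) (hn : n ≤ T) :
    (∑ t ∈ Finset.Icc 1 n, (1 / e t) * (hh (u / w t) - hh (u / w (t + 1))))
      + (1 / e n) * hh (u / w (n + 1)) ≤ (1 / η) * hh (u * d) ∧
    (∑ t ∈ Finset.Icc 1 n, (1 / e t) * (hh (u / w t) - hh (u / w (t + 1))))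
      + (1 / e n) * hh (u / w (n + 1)) ≤ (1 / η) * hh (u * d)
        + (Real.log T / η + 2 * d * u / (10 * η * Real.log T))
        - r n * u / (10 * η * Real.log T) := by
  have hTpos : (0 : ℝ) < T := by positivity
  have hL2 : Real.log 2 ≤ Real.log T := Real.log_le_log (by norm_num) (by exact_mod_cast hT)
  have hL : 0 < Real.log T := by linarith [Real.log_two_gt_d9]
  have hK : 0 ≤ 2 * d * u / (10 * η * Real.log T) := by positivity
  have hK' : 0 ≤ Real.log T / η := by positivity
  have hrate : ∀ m, 1 ≤ m → m ≤ T → 0 < e m ∧ e m ≤ 5 * η ∧ 0 < r m ∧ r m ≤ 2 * T :=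
    fun m h1 h2 => rate_bd hT hη (rates d T η w e r hd hT hw1 he1 hr1 hw hupd m h1 h2)
  induction n, hn1 using Nat.le_induction with
  | base =>
    have e1 : u / w 1 = u * d := by rw [hw1]; simp
    simp only [Finset.Icc_self, Finset.sum_singleton, e1, he1, hr1]
    constructor
    · linarith
    · linarith
  | succ n hn1 ih =>
    obtain ⟨i1, i2⟩ := ih (by omega)
    have hupdn := hupd n (by simp; omega)
    have hwn : 0 < w (n + 1) :=
      lt_of_lt_of_le (by positivity) (hw (n + 1) (by simp; omega))
    obtain ⟨p1, p2, p3, p4⟩ := hrate n hn1 (by omega)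
    obtain ⟨q1, q2, q3, q4⟩ := hrate (n + 1) (by omega) hn
    rw [Finset.sum_Icc_succ_top (by omega)]
    by_cases hc : 1 / w (n + 1) > r n
    · obtain ⟨a, b⟩ := hupdn.1 hc
      have hx : 0 < u / w (n + 1) := div_pos hu hwn
      have hx2 : 2 * (u / w (n + 1)) = r (n + 1) * u := by rw [a]; ring
      have hxT : u / w (n + 1) ≤ T := by nlinarith
      have g := gain (x := u / w (n + 1)) hη hL2 rfl p1 (b ▸ q2) hx (Real.log_le_log hx hxT)
      rw [← b, hx2] at g
      have g0 : (1 / e (n + 1) - 1 / e n) * hh (u / w (n + 1)) ≤ 0 := by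
        apply mul_nonpos_of_nonpos_of_nonneg _ (hh_nonneg hx)
        have : e n ≤ e (n + 1) := by
          rw [b]
          have : 1 ≤ Real.exp (1 / Real.log T) := Real.one_le_exp (by positivity)
          nlinarith
        linarith [one_div_le_one_div_of_le p1 this]
      constructor
      · linarith
      · linarith
    · obtain ⟨a, b⟩ := hupdn.2 hc
      rw [a, b]
      constructor
      · linarith
      · linarith

/-- **Lemma 2.1: regret of log-barrier OMD with increasing learning rates (MAB).**
The algorithm runs over the clipped simplex `{w : ∀ i, 1/T ≤ w i, ∑ w i = 1}` with the
log-barrier regularizer `ψ_t(w) = ∑_i (1/η_{t,i}) ln (1/w_i)` (whose Bregman divergence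
is `D_{ψ_t}(u,w) = ∑_i (1/η_{t,i}) (u_i/w_i − 1 − ln (u_i/w_i))`), importance-weighted
estimators `ℓ̂_{t,i} = (ℓ_{t,i}/w_{t,i}) 1{i_t = i}`, and the threshold-based
learning-rate increase schedule with factor `κ = e^{1/ln T}`.  Then deterministically,
for every realization and every `u` in the clipped simplex,
`∑_{t=1}^T (ℓ_{t,i_t} − ⟨u, ℓ̂_t⟩) ≤ O(d ln T/η + η ∑_t ℓ_{t,i_t}) − ⟨ρ_T,u⟩/(10 η ln T)`. -/
theorem mab_log_barrier_omd_regret :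
    ∃ c : ℝ, 0 < c ∧
    ∀ (d T : ℕ) (η : ℝ) (ℓ : ℕ → Fin d → ℝ) (it : ℕ → Fin d)
      (w ηv ρ : ℕ → Fin d → ℝ) (u : Fin d → ℝ),
    1 ≤ d → 2 ≤ T → 0 < η →
    -- losses in [0,1]
    (∀ t ∈ Finset.Icc 1 T, ∀ i, ℓ t i ∈ Set.Icc (0 : ℝ) 1) →
    -- u lies in the clipped simplex
    (∀ i, 1 / (T : ℝ) ≤ u i) → (∑ i, u i = 1) →
    -- initialization
    (∀ i, w 1 i = 1 / (d : ℝ)) → (∀ i, ηv 1 i = η) → (∀ i, ρ 1 i = 2 * d) →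
    -- iterates lie in the clipped simplex
    (∀ t ∈ Finset.Icc 1 (T + 1), (∀ i, 1 / (T : ℝ) ≤ w t i) ∧ (∑ i, w t i = 1)) →
    -- OMD update: w (t+1) minimizes ⟨·, ℓ̂_t⟩ + D_{ψ_t}(·, w t) over the clipped simplex
    (∀ t ∈ Finset.Icc 1 T, ∀ v : Fin d → ℝ,
      (∀ i, 1 / (T : ℝ) ≤ v i) → (∑ i, v i = 1) →
      (∑ i, w (t + 1) i * (if it t = i then ℓ t i / w t i else 0)) +
        (∑ i, (1 / ηv t i) *
          (w (t + 1) i / w t i - 1 - Real.log (w (t + 1) i / w t i)))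
      ≤ (∑ i, v i * (if it t = i then ℓ t i / w t i else 0)) +
        (∑ i, (1 / ηv t i) * (v i / w t i - 1 - Real.log (v i / w t i)))) →
    -- learning-rate and threshold update with κ = e^{1/ln T}
    (∀ t ∈ Finset.Icc 1 T, ∀ i,
      (1 / w (t + 1) i > ρ t i →
        ρ (t + 1) i = 2 / w (t + 1) i ∧
        ηv (t + 1) i = Real.exp (1 / Real.log T) * ηv t i) ∧
      (¬ (1 / w (t + 1) i > ρ t i) →
        ρ (t + 1) i = ρ t i ∧ ηv (t + 1) i = ηv t i)) →
    ∑ t ∈ Finset.Icc 1 T,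
        (ℓ t (it t) - ∑ i, u i * (if it t = i then ℓ t i / w t i else 0))
      ≤ c * ((d : ℝ) * Real.log T / η + η * ∑ t ∈ Finset.Icc 1 T, ℓ t (it t))
        - (∑ i, ρ T i * u i) / (10 * η * Real.log T) := by
  refine ⟨6, by norm_num, ?_⟩
  intro d T η ℓ it w ηv ρ u hd hT hη hℓ hu hu1 hw1 he1 hr1 hw hmin hupd
  have hTpos : (0 : ℝ) < T := by positivity
  have hdpos : (0 : ℝ) < d := by exact_mod_cast hd
  have hL2 : Real.log 2 ≤ Real.log T := Real.log_le_log (by norm_num) (by exact_mod_cast hT)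
  have hl2 := Real.log_two_gt_d9
  have hL : 0 < Real.log T := by linarith
  have hiT : 0 < 1 / (T : ℝ) := by positivity
  have hup : ∀ i, 0 < u i := fun i => lt_of_lt_of_le hiT (hu i)
  have hule : ∀ i, u i ≤ 1 := fun i => by
    rw [← hu1]
    exact Finset.single_le_sum (f := u) (fun j _ => (hup j).le) (Finset.mem_univ i)
  have hwp : ∀ t ∈ Finset.Icc 1 (T + 1), ∀ i, 0 < w t i :=
    fun t ht i => lt_of_lt_of_le hiT ((hw t ht).1 i)
  have hrate : ∀ t ∈ Finset.Icc 1 T, ∀ i, 0 < ηv t i ∧ ηv t i ≤ 5 * η := by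
    intro t ht i
    rw [Finset.mem_Icc] at ht
    have := rate_bd hT hη (rates d T η (fun t => w t i) (fun t => ηv t i) (fun t => ρ t i)
      hd hT (hw1 i) (he1 i) (hr1 i) (fun t ht => (hw t ht).1 i) (fun t ht => hupd t ht i)
      t ht.1 ht.2)
    exact ⟨this.1, this.2.1⟩
  have hstep : ∀ t ∈ Finset.Icc 1 T,
      ℓ t (it t) - ∑ i, u i * (if it t = i then ℓ t i / w t i else 0)
      ≤ 5 * η * ℓ t (it t)
        + ∑ i, (1 / ηv t i) * (hh (u i / w t i) - hh (u i / w (t + 1) i)) := by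
    intro t ht
    have ht' := Finset.mem_Icc.1 ht
    have m1 : t ∈ Finset.Icc 1 (T + 1) := Finset.mem_Icc.2 ⟨ht'.1, by omega⟩
    have m2 : t + 1 ∈ Finset.Icc 1 (T + 1) := Finset.mem_Icc.2 ⟨by omega, by omega⟩
    have h := one_step (w t) (w (t + 1)) u (ηv t) (ℓ t) (it t) (hwp t m1) (hwp _ m2) hup
      (fun i => (hrate t ht i).1) (hℓ t ht (it t)) (by
        intro s hs0 hs1
        refine hmin t ht (fun i => w (t + 1) i + s * (u i - w (t + 1) i)) ?_ ?_
        · intro i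
          have a1 := (hw _ m2).1 i
          have a2 := hu i
          nlinarith
        · rw [Finset.sum_add_distrib, ← Finset.mul_sum, Finset.sum_sub_distrib, hu1, (hw _ m2).2]
          ring)
    have h2 := mul_le_mul_of_nonneg_right (hrate t ht (it t)).2 (hℓ t ht (it t)).1
    linarith
  refine (Finset.sum_le_sum hstep).trans ?_
  rw [Finset.sum_add_distrib, ← Finset.mul_sum, Finset.sum_comm]
  have hS : 0 ≤ ∑ t ∈ Finset.Icc 1 T, ℓ t (it t) :=
    Finset.sum_nonneg fun t ht => (hℓ t ht (it t)).1
  have hcoord : ∀ i ∈ (Finset.univ : Finset (Fin d)),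
      ∑ t ∈ Finset.Icc 1 T, (1 / ηv t i) * (hh (u i / w t i) - hh (u i / w (t + 1) i))
      ≤ (1 / η) * (u i * d - 1 + Real.log T)
        + (Real.log T / η + 2 * d / (10 * η * Real.log T) * u i)
        - (1 / (10 * η * Real.log T)) * (ρ T i * u i) := by
    intro i _
    have h := (coord d T η (u i) (fun t => w t i) (fun t => ηv t i) (fun t => ρ t i)
      hd hT hη (hup i) (hule i) (hw1 i) (he1 i) (hr1 i) (fun t ht => (hw t ht).1 i)
      (fun t ht => hupd t ht i) T (by omega) le_rfl).2
    have hTm : T ∈ Finset.Icc 1 T := Finset.mem_Icc.2 ⟨by omega, le_rfl⟩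
    have hT1 : T + 1 ∈ Finset.Icc 1 (T + 1) := Finset.mem_Icc.2 ⟨by omega, le_rfl⟩
    have h1 : 0 ≤ (1 / ηv T i) * hh (u i / w (T + 1) i) :=
      mul_nonneg (one_div_pos.2 (hrate T hTm i).1).le (hh_nonneg (div_pos (hup i) (hwp _ hT1 i)))
    have h2 : (1 / η) * hh (u i * d) ≤ (1 / η) * (u i * d - 1 + Real.log T) := by
      apply mul_le_mul_of_nonneg_left _ (by positivity)
      unfold hh
      have h3 : 1 / (T : ℝ) ≤ u i * d := by
        have : (1 : ℝ) ≤ d := by exact_mod_cast hd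
        nlinarith [hu i, hup i]
      have h4 := Real.log_le_log hiT h3
      rw [one_div, Real.log_inv] at h4
      linarith
    have e1 : 2 * d * u i / (10 * η * Real.log T) = 2 * d / (10 * η * Real.log T) * u i := by ring
    have e2 : ρ T i * u i / (10 * η * Real.log T)
      = (1 / (10 * η * Real.log T)) * (ρ T i * u i) := by ring
    simp only [e1, e2] at h
    linarith
  have hfin := Finset.sum_le_sum hcoord
  have e1 : ∑ i, ((1 / η) * (u i * d - 1 + Real.log T)
        + (Real.log T / η + 2 * d / (10 * η * Real.log T) * u i)
        - (1 / (10 * η * Real.log T)) * (ρ T i * u i))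
      = 2 * (d * Real.log T / η) + 2 * d / (10 * η * Real.log T)
        - (∑ i, ρ T i * u i) / (10 * η * Real.log T) := by
    rw [Finset.sum_sub_distrib, Finset.sum_add_distrib, ← Finset.mul_sum, ← Finset.mul_sum,
      Finset.sum_add_distrib, Finset.sum_add_distrib, ← Finset.mul_sum, Finset.sum_sub_distrib,
      ← Finset.sum_mul, hu1]
    simp only [Finset.sum_const, Finset.card_univ, Fintype.card_fin, nsmul_eq_mul]
    ring
  rw [e1] at hfin
  have h5 : 2 * d / (10 * η * Real.log T) ≤ d * Real.log T / η := by
    rw [div_le_div_iff₀ (by positivity) hη]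
    have : 2 ≤ 10 * Real.log T ^ 2 := by nlinarith
    have := mul_le_mul_of_nonneg_left this (mul_pos hdpos hη).le
    linarith
  have h6 : 0 ≤ d * Real.log T / η := by positivity
  have h7 : 0 ≤ η * ∑ t ∈ Finset.Icc 1 T, ℓ t (it t) := mul_nonneg hη.le hS
  linarith
end

section
/- Lemma B.9 (bound on the number of learning-rate increases): Assume T ≥ 8. The number n of times Algorithm 2 increases its learning rate over T rounds satisfies n ≤ 100 d log₂(νT). Consequently, η_t ≤ κⁿ·η ≤ 5η for all t ∈ [T], where κ = e^{1/(100 d ln(νT))}. -/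
open MeasureTheory Real Finset Matrix

/-! Common notions for the linear-bandit setting (self-concordant barriers,
the lifted normal barrier, quadratic norms, Bregman divergences, Minkowsky functions). -/

/-- Euclidean dot product on `ℝ^n`. -/
noncomputable def dotp {n : ℕ} (x y : Fin n → ℝ) : ℝ := ∑ i, x i * y i

/-- Quadratic norm `‖h‖_M = √(hᵀ M h)`. -/
noncomputable def qnorm {n : ℕ} (M : Matrix (Fin n) (Fin n) ℝ) (h : Fin n → ℝ) : ℝ :=
  Real.sqrt (dotp h (M.mulVec h))

/-- First directional derivative `Df(x)[h]`. -/
noncomputable def der1 {n : ℕ} (f : (Fin n → ℝ) → ℝ) (x h : Fin n → ℝ) : ℝ :=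
  fderiv ℝ f x h

/-- Second directional derivative `D²f(x)[h₁,h₂]`. -/
noncomputable def der2 {n : ℕ} (f : (Fin n → ℝ) → ℝ) (x h₁ h₂ : Fin n → ℝ) : ℝ :=
  iteratedFDeriv ℝ 2 f x ![h₁, h₂]

/-- Third directional derivative `D³f(x)[h,h,h]`. -/
noncomputable def der3 {n : ℕ} (f : (Fin n → ℝ) → ℝ) (x h : Fin n → ℝ) : ℝ :=
  iteratedFDeriv ℝ 3 f x ![h, h, h]

/-- Hessian matrix `∇²f(x)`. -/
noncomputable def hess {n : ℕ} (f : (Fin n → ℝ) → ℝ) (x : Fin n → ℝ) :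
    Matrix (Fin n) (Fin n) ℝ :=
  Matrix.of fun i j => der2 f x (Pi.single i 1) (Pi.single j 1)

/-- Gradient vector `∇f(x)`. -/
noncomputable def gradv {n : ℕ} (f : (Fin n → ℝ) → ℝ) (x : Fin n → ℝ) : Fin n → ℝ :=
  fun i => fderiv ℝ f x (Pi.single i 1)

/-- Bregman divergence `D_f(u,w) = f(u) − f(w) − ⟨∇f(w), u − w⟩`. -/
noncomputable def breg {n : ℕ} (f : (Fin n → ℝ) → ℝ) (u w : Fin n → ℝ) : ℝ :=
  f u - f w - dotp (gradv f w) (u - w)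

/-- `ψ` is a `ν`-self-concordant barrier for `K`. -/
structure IsSCB {n : ℕ} (K : Set (Fin n → ℝ)) (ψ : (Fin n → ℝ) → ℝ) (ν : ℝ) : Prop where
  smooth : ContDiffOn ℝ 3 ψ (interior K)
  convexOn : ConvexOn ℝ (interior K) ψ
  blowup : ∀ x ∈ frontier K, Filter.Tendsto ψ (nhdsWithin x (interior K)) Filter.atTop
  selfConc : ∀ w ∈ interior K, ∀ h, |der3 ψ w h| ≤ 2 * Real.sqrt (der2 ψ w h h) ^ 3
  gradBound : ∀ w ∈ interior K, ∀ h,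
    |der1 ψ w h| ≤ Real.sqrt ν * Real.sqrt (der2 ψ w h h)

/-- Lift `w ∈ ℝ^d` to `(w,1) ∈ ℝ^{d+1}`. -/
noncomputable def liftv {d : ℕ} (w : Fin d → ℝ) : Fin (d + 1) → ℝ := Fin.snoc w 1

/-- The lifted barrier `Ψ(w,b) = 400 (ψ(w/b) − 2ν ln b)`, an `800ν`-normal barrier on
the conic hull of `Ω⁺`. -/
noncomputable def liftedBarrier {d : ℕ} (ψ : (Fin d → ℝ) → ℝ) (ν : ℝ) :
    (Fin (d + 1) → ℝ) → ℝ :=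
  fun x => 400 * (ψ (fun i => x i.castSucc / x (Fin.last d)) -
    2 * ν * Real.log (x (Fin.last d)))

/-- Minkowsky function `π_w(u) = inf {s > 0 : w + (u − w)/s ∈ K}`. -/
noncomputable def mink {n : ℕ} (K : Set (Fin n → ℝ)) (w u : Fin n → ℝ) : ℝ :=
  sInf {s : ℝ | 0 < s ∧ w + s⁻¹ • (u - w) ∈ K}

lemma line1 {n : ℕ} {f : (Fin n → ℝ) → ℝ} {x h : Fin n → ℝ} {t : ℝ}
    (hf : DifferentiableAt ℝ f (x + t • h)) :
    HasDerivAt (fun t : ℝ => f (x + t • h)) (der1 f (x + t • h) h) t := by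
  have h1 : HasDerivAt (fun t : ℝ => x + t • h) h t := by
    simpa using ((hasDerivAt_id t).smul_const h).const_add x
  exact hf.hasFDerivAt.comp_hasDerivAt t h1

lemma der2_eq {n : ℕ} (f : (Fin n → ℝ) → ℝ) (x a b : Fin n → ℝ) :
    der2 f x a b = fderiv ℝ (fderiv ℝ f) x a b := by
  simp [der2, iteratedFDeriv_two_apply]

lemma line2 {n : ℕ} {f : (Fin n → ℝ) → ℝ} {x h : Fin n → ℝ} {t : ℝ}
    (hf : ContDiffAt ℝ 2 f (x + t • h)) :
    HasDerivAt (fun t : ℝ => der1 f (x + t • h) h) (der2 f (x + t • h) h h) t := by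
  have h1 : HasDerivAt (fun t : ℝ => x + t • h) h t := by
    simpa using ((hasDerivAt_id t).smul_const h).const_add x
  have h2 : DifferentiableAt ℝ (fderiv ℝ f) (x + t • h) :=
    (hf.fderiv_right (m := 1) (by norm_num)).differentiableAt (by norm_num)
  have h3 := h2.hasFDerivAt.comp_hasDerivAt t h1
  have h4 : HasDerivAt (fun t : ℝ => fderiv ℝ f (x + t • h) h)
      (fderiv ℝ (fderiv ℝ f) (x + t • h) h h) t :=
    (ContinuousLinearMap.apply ℝ ℝ h).hasFDerivAt.comp_hasDerivAt t h3
  rw [der2_eq]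
  exact h4

lemma line3 {n : ℕ} {f : (Fin n → ℝ) → ℝ} {x h : Fin n → ℝ} {t : ℝ}
    (hf : ContDiffAt ℝ 3 f (x + t • h)) :
    HasDerivAt (fun t : ℝ => der2 f (x + t • h) h h) (der3 f (x + t • h) h) t := by
  have h1 : HasDerivAt (fun t : ℝ => x + t • h) h t := by
    simpa using ((hasDerivAt_id t).smul_const h).const_add x
  have h2 : DifferentiableAt ℝ (iteratedFDeriv ℝ 2 f) (x + t • h) :=
    hf.differentiableAt_iteratedFDeriv (by norm_cast)
  have h3 := h2.hasFDerivAt.comp_hasDerivAt t h1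
  have h4 : HasDerivAt (fun t : ℝ => iteratedFDeriv ℝ 2 f (x + t • h) ![h, h])
      (fderiv ℝ (iteratedFDeriv ℝ 2 f) (x + t • h) h ![h, h]) t :=
    (ContinuousMultilinearMap.apply ℝ (fun _ : Fin 2 => Fin n → ℝ) ℝ
      ![h, h]).hasFDerivAt.comp_hasDerivAt t h3
  have e : der3 f (x + t • h) h = fderiv ℝ (iteratedFDeriv ℝ 2 f) (x + t • h) h ![h, h] := by
    rw [der3, iteratedFDeriv_succ_apply_left]
    rfl
  rw [e]
  exact h4

lemma sc_lip {s : Set ℝ} (hs : Convex ℝ s) {g g' : ℝ → ℝ}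
    (hd : ∀ t ∈ s, HasDerivAt g (g' t) t) (h0 : ∀ t ∈ s, 0 ≤ g t)
    (hb : ∀ t ∈ s, |g' t| ≤ 2 * Real.sqrt (g t) ^ 3) {ε : ℝ} (hε : 0 < ε)
    {a b : ℝ} (ha : a ∈ s) (hb' : b ∈ s) :
    |(Real.sqrt (g b + ε))⁻¹ - (Real.sqrt (g a + ε))⁻¹| ≤ |b - a| := by
  have key := hs.norm_image_sub_le_of_norm_hasDerivWithin_le (C := 1)
    (f := fun t => (Real.sqrt (g t + ε))⁻¹)
    (f' := fun t => -(g' t / (2 * Real.sqrt (g t + ε))) / Real.sqrt (g t + ε) ^ 2)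
    (fun t ht => ?_) (fun t ht => ?_) ha hb'
  · simpa using key
  · have hp : 0 < g t + ε := by linarith [h0 t ht]
    exact (((hd t ht).add_const ε).sqrt hp.ne').inv (Real.sqrt_pos.2 hp).ne' |>.hasDerivWithinAt
  · have hp : 0 < g t + ε := by linarith [h0 t ht]
    have hq := Real.sqrt_pos.2 hp
    rw [Real.norm_eq_abs, abs_div, abs_neg, abs_div, abs_of_pos (by positivity : 0 < 2 * √(g t + ε)),
      abs_of_pos (by positivity : 0 < √(g t + ε) ^ 2), div_div, div_le_one (by positivity)]
    have h5 : Real.sqrt (g t) ≤ √(g t + ε) := Real.sqrt_le_sqrt (by linarith)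
    have h6 : Real.sqrt (g t) ^ 3 ≤ √(g t + ε) ^ 3 := by gcongr
    calc |g' t| ≤ _ := hb t ht
      _ ≤ 2 * √(g t + ε) ^ 3 := by linarith
      _ = _ := by ring

/-- upper bound -/
lemma sc_upper {τ : ℝ} (hτ1 : τ ≤ 1) {g g' : ℝ → ℝ}
    (hd : ∀ t ∈ Set.Ico 0 τ, HasDerivAt g (g' t) t) (h0 : ∀ t ∈ Set.Ico 0 τ, 0 ≤ g t)
    (hb : ∀ t ∈ Set.Ico 0 τ, |g' t| ≤ 2 * Real.sqrt (g t) ^ 3) (hg : g 0 < 1 / 4) :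
    ∀ t ∈ Set.Ico 0 τ, g t ≤ 1 := by
  intro t ht
  have ht0 : (0:ℝ) ∈ Set.Ico 0 τ := ⟨le_rfl, ht.1.trans_lt ht.2⟩
  have hε : 0 < 1 / 4 - g 0 := by linarith
  have := sc_lip (convex_Ico 0 τ) hd h0 hb hε ht0 ht
  have e : √(g 0 + (1 / 4 - g 0)) = 1 / 2 := by
    rw [show g 0 + (1 / 4 - g 0) = (1 / 2) ^ 2 by ring]
    exact Real.sqrt_sq (by norm_num)
  rw [e, sub_zero, abs_of_nonneg ht.1, abs_le] at this
  have hp : 0 < g t + (1 / 4 - g 0) := by linarith [h0 t ht]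
  have hq := Real.sqrt_pos.2 hp
  have h1 : 1 ≤ (√(g t + (1 / 4 - g 0)))⁻¹ := by
    have := ht.2
    norm_num at *; linarith
  have h2 := (one_le_inv₀ hq).1 h1
  rw [Real.sqrt_le_one] at h2
  linarith

lemma sc_lower {τ r : ℝ} (hr : 0 < r) (hτ1 : τ = 1 / r) {g g' : ℝ → ℝ}
    (hd : ∀ t ∈ Set.Icc 0 τ, HasDerivAt g (g' t) t) (h0 : ∀ t ∈ Set.Icc 0 τ, 0 ≤ g t)
    (hb : ∀ t ∈ Set.Icc 0 τ, |g' t| ≤ 2 * Real.sqrt (g t) ^ 3) (hg : r ^ 2 ≤ g 0) :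
    ∀ t ∈ Set.Icc 0 τ, r ^ 2 / 4 ≤ g t := by
  intro t ht
  have ht0 : (0:ℝ) ∈ Set.Icc 0 τ := ⟨le_rfl, ht.1.trans ht.2⟩
  refine le_of_forall_pos_le_add fun ε hε => ?_
  have := sc_lip (convex_Icc 0 τ) hd h0 hb hε ht0 ht
  rw [sub_zero, abs_of_nonneg ht.1, abs_le] at this
  have hp : 0 < g t + ε := by linarith [h0 t ht]
  have hq := Real.sqrt_pos.2 hp
  have h1 : (√(g 0 + ε))⁻¹ ≤ r⁻¹ := by
    gcongr
    apply Real.le_sqrt_of_sq_le; linarith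
  have h2 : (√(g t + ε))⁻¹ ≤ 2 * r⁻¹ := by
    have := ht.2
    rw [hτ1, one_div] at this
    linarith
  have h3 : r / 2 ≤ √(g t + ε) := by
    have := inv_anti₀ (inv_pos.2 hq) h2
    simpa [mul_inv, div_eq_mul_inv, mul_comm] using this
  have := (Real.le_sqrt (by positivity) hp.le).1 h3
  linarith [this, show (r/2)^2 = r^2/4 by ring]

/-- barrier bound in one dimension -/
lemma bar1D {ν : ℝ} (hν : 1 ≤ ν) {p g g' : ℝ → ℝ}
    (hp : ∀ t ∈ Set.Icc (0:ℝ) 1, HasDerivAt p (g t) t)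
    (hd : ∀ t ∈ Set.Icc (0:ℝ) 1, HasDerivAt g (g' t) t) (h0 : ∀ t ∈ Set.Icc (0:ℝ) 1, 0 ≤ g t)
    (hb : ∀ t ∈ Set.Icc (0:ℝ) 1, |g' t| ≤ 2 * Real.sqrt (g t) ^ 3)
    (hpb : ∀ t ∈ Set.Icc (0:ℝ) 1, |p t| ≤ Real.sqrt ν * Real.sqrt (g t))
    (hp0 : 0 ≤ p 0) : g 0 ≤ (5 * ν) ^ 2 := by
  by_contra! hc
  set r := 5 * ν with hr
  have hr5 : 5 ≤ r := by linarith
  have hr0 : 0 < r := by linarith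
  have hτ : 1 / r ≤ 1 := by rw [div_le_one hr0]; linarith
  have hτ0 : 0 < 1 / r := by positivity
  have sub : ∀ t ∈ Set.Icc 0 (1 / r), t ∈ Set.Icc (0:ℝ) 1 := fun t ht => ⟨ht.1, ht.2.trans hτ⟩
  have low := sc_lower hr0 rfl (fun t ht => hd t (sub t ht)) (fun t ht => h0 t (sub t ht))
    (fun t ht => hb t (sub t ht)) hc.le
  -- p (1/r) ≥ r / 4
  have hmono : MonotoneOn (fun t => p t - r ^ 2 / 4 * t) (Set.Icc 0 (1 / r)) := by
    have D : ∀ t ∈ Set.Icc 0 (1/r), HasDerivAt (fun t => p t - r ^ 2 / 4 * t) (g t - r ^ 2 / 4) t := by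
      intro t ht
      have := (hp t (sub t ht)).sub ((hasDerivAt_id t).const_mul (r ^ 2 / 4))
      rw [mul_one] at this
      exact this
    apply monotoneOn_of_deriv_nonneg (convex_Icc _ _)
    · exact fun t ht => (D t ht).continuousAt.continuousWithinAt
    · intro t ht
      exact (D t (interior_subset ht)).differentiableAt.differentiableWithinAt
    · intro t ht
      rw [(D t (interior_subset ht)).deriv]
      linarith [low t (interior_subset ht)]
  have hpr : r / 4 ≤ p (1 / r) := by
    have := hmono (Set.left_mem_Icc.2 hτ0.le) (Set.right_mem_Icc.2 hτ0.le) hτ0.le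
    have e : r ^ 2 / 4 * (1 / r) = r / 4 := by field_simp
    simp only [e] at this
    linarith
  have hpm : MonotoneOn p (Set.Icc 0 1) := by
    apply monotoneOn_of_deriv_nonneg (convex_Icc _ _)
    · exact fun t ht => (hp t ht).continuousAt.continuousWithinAt
    · intro t ht
      exact (hp t (interior_subset ht)).differentiableAt.differentiableWithinAt
    · intro t ht
      rw [(hp t (interior_subset ht)).deriv]
      exact h0 t (interior_subset ht)
  have sub2 : ∀ t ∈ Set.Icc (1 / r) 1, t ∈ Set.Icc (0:ℝ) 1 := fun t ht => ⟨hτ0.le.trans ht.1, ht.2⟩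
  have hpp : ∀ t ∈ Set.Icc (1 / r) 1, 0 < p t := by
    intro t ht
    have := hpm ⟨hτ0.le, hτ⟩ (sub2 t ht) ht.1
    linarith
  have hanti : AntitoneOn (fun t => (p t)⁻¹ + t / ν) (Set.Icc (1 / r) 1) := by
    have D : ∀ t ∈ Set.Icc (1/r) 1, HasDerivAt (fun t => (p t)⁻¹ + t / ν) (- g t / p t ^ 2 + 1 / ν) t := by
      intro t ht
      exact ((hp t (sub2 t ht)).inv (hpp t ht).ne').add ((hasDerivAt_id t).div_const ν)
    apply antitoneOn_of_deriv_nonpos (convex_Icc _ _)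
    · exact fun t ht => (D t ht).continuousAt.continuousWithinAt
    · intro t ht
      exact (D t (interior_subset ht)).differentiableAt.differentiableWithinAt
    · intro t ht
      have ht := interior_subset ht
      rw [(D t ht).deriv]
      have h1 := hpb t (sub2 t ht)
      have h2 := hpp t ht
      rw [abs_of_pos h2] at h1
      have h3 : p t ^ 2 ≤ ν * g t := by
        calc p t ^ 2 ≤ (√ν * √(g t)) ^ 2 := by gcongr
          _ = _ := by rw [mul_pow, Real.sq_sqrt (by linarith), Real.sq_sqrt (h0 t (sub2 t ht))]
      have h4 : 1 / ν ≤ g t / p t ^ 2 := by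
        rw [div_le_div_iff₀ (by linarith) (by positivity)]; linarith
      rw [neg_div]; linarith
  have h1 := hanti (Set.left_mem_Icc.2 hτ) (Set.right_mem_Icc.2 hτ) hτ
  simp only at h1
  have h2 : 0 < (p 1)⁻¹ := inv_pos.2 (hpp 1 (Set.right_mem_Icc.2 hτ))
  have h3 : (p (1 / r))⁻¹ ≤ 4 / r := by
    rw [show 4 / r = (r / 4)⁻¹ by simp]
    exact inv_anti₀ (by positivity) hpr
  have h4 : 4 / r = (4 / 5) / ν := by rw [hr]; field_simp
  have h5 : 1 / r / ν ≤ (1 / 5) / ν := by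
    gcongr
  have h6 : (4/5)/ν + (1/5)/ν = 1 / ν := by ring
  linarith

section body
variable {n : ℕ} {K : Set (Fin n → ℝ)} {ψ : (Fin n → ℝ) → ℝ} {ν : ℝ}

lemma scb_cd (h : IsSCB K ψ ν) {w : Fin n → ℝ} (hw : w ∈ interior K) : ContDiffAt ℝ 3 ψ w :=
  h.smooth.contDiffAt (isOpen_interior.mem_nhds hw)

lemma scb_nonneg (h : IsSCB K ψ ν) {w : Fin n → ℝ} (hw : w ∈ interior K) (k : Fin n → ℝ) :
    0 ≤ der2 ψ w k k := by
  have hc : Continuous (fun t : ℝ => w + t • k) := by fun_prop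
  obtain ⟨r, hr, hball⟩ := Metric.isOpen_iff.1 (isOpen_interior.preimage hc) 0 (by simpa using hw)
  have hconv : ConvexOn ℝ (Metric.ball (0:ℝ) r) (fun t : ℝ => ψ (w + t • k)) := by
    have := h.convexOn.comp_affineMap (AffineMap.lineMap w (w + k))
    have e : (ψ ∘ (AffineMap.lineMap w (w + k) : ℝ →ᵃ[ℝ] (Fin n → ℝ))) = fun t : ℝ => ψ (w + t • k) := by
      ext t; simp [AffineMap.lineMap_apply, add_comm]
    rw [e] at this
    refine this.subset ?_ (convex_ball _ _)
    intro t ht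
    have := hball ht
    simpa [AffineMap.lineMap_apply, add_comm] using this
  have hd : ∀ t ∈ Metric.ball (0:ℝ) r, HasDerivAt (fun t : ℝ => ψ (w + t • k)) (der1 ψ (w + t • k) k) t :=
    fun t ht => line1 ((scb_cd h (hball ht)).differentiableAt (by norm_num))
  have hm : MonotoneOn (fun t : ℝ => der1 ψ (w + t • k) k) (Metric.ball (0:ℝ) r) := by
    have := hconv.monotoneOn_deriv (fun t ht => (hd t ht).differentiableAt)
    exact this.congr (fun t ht => (hd t ht).deriv)
  have h2 := line2 (f := ψ) (x := w) (h := k) (t := 0)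
    ((scb_cd h (by simpa using hw)).of_le (by norm_num))
  have h3 := h2.hasDerivWithinAt (s := Metric.ball (0:ℝ) r)
  have h4 := hm.derivWithin_nonneg (x := 0)
  rw [h3.derivWithin (Metric.isOpen_ball.uniqueDiffWithinAt (Metric.mem_ball_self hr))] at h4
  simpa using h4

lemma der_neg (w k : Fin n → ℝ) : der2 ψ w (-k) (-k) = der2 ψ w k k := by
  simp [der2_eq]

lemma der2_smul (c : ℝ) (w k : Fin n → ℝ) : der2 ψ w (c • k) (c • k) = c ^ 2 * der2 ψ w k k := by
  simp [der2_eq]; ring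

/-- Fact B -/
lemma factB (hK : Convex ℝ K) (h : IsSCB K ψ ν) (hν : 1 ≤ ν) {x k : Fin n → ℝ} (hx : x ∈ interior K)
    (h1 : x + k ∈ interior K) (h2 : x - k ∈ interior K) : der2 ψ x k k ≤ (5 * ν) ^ 2 := by
  have main : ∀ k : Fin n → ℝ, x + k ∈ interior K → 0 ≤ der1 ψ x k → der2 ψ x k k ≤ (5 * ν) ^ 2 := by
    intro k hk h0
    have seg : ∀ t ∈ Set.Icc (0:ℝ) 1, x + t • k ∈ interior K := by
      intro t ht
      have := hK.interior hx hk (sub_nonneg.2 ht.2) ht.1 (by ring)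
      convert this using 1
      module
    have := bar1D hν (p := fun t => der1 ψ (x + t • k) k) (g := fun t => der2 ψ (x + t • k) k k)
      (g' := fun t => der3 ψ (x + t • k) k)
      (fun t ht => line2 ((scb_cd h (seg t ht)).of_le (by norm_num)))
      (fun t ht => line3 (scb_cd h (seg t ht)))
      (fun t ht => scb_nonneg h (seg t ht) k)
      (fun t ht => h.selfConc _ (seg t ht) k)
      (fun t ht => h.gradBound _ (seg t ht) k)
      (by simpa using h0)
    simpa using this
  rcases le_total 0 (der1 ψ x k) with h0 | h0
  · exact main k h1 h0
  · rw [← der_neg]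
    refine main (-k) (by simpa [sub_eq_add_neg] using h2) ?_
    simpa [der1] using h0

/-- Dikin -/
lemma dikin (hK : IsClosed K) (h : IsSCB K ψ ν) {w k : Fin n → ℝ} (hw : w ∈ interior K)
    (hk : der2 ψ w k k < 1 / 4) : w + k ∈ interior K := by
  by_contra hc
  have hcont : Continuous (fun t : ℝ => w + t • k) := by fun_prop
  set B : Set ℝ := {t | t ∈ Set.Icc (0:ℝ) 1 ∧ w + t • k ∉ interior K} with hB
  have hBc : IsCompact B := by
    have : IsClosed ((fun t : ℝ => w + t • k) ⁻¹' (interior K)ᶜ) :=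
      isOpen_interior.isClosed_compl.preimage hcont
    exact isCompact_Icc.inter_right this
  have hBn : B.Nonempty := ⟨1, ⟨by norm_num, le_rfl⟩, by simpa using hc⟩
  obtain ⟨τ, hτB, hτ⟩ := hBc.exists_isLeast hBn
  have seg : ∀ t ∈ Set.Ico 0 τ, w + t • k ∈ interior K := by
    intro t ht
    by_contra hn
    exact absurd (hτ ⟨⟨ht.1, ht.2.le.trans hτB.1.2⟩, hn⟩) (not_le.2 ht.2)
  have hτ0 : 0 < τ := by
    rcases hτB.1.1.eq_or_lt with e | e
    · exact absurd (by simpa [← e] using hw) hτB.2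
    · exact e
  have htend : Filter.Tendsto (fun t : ℝ => w + t • k) (nhdsWithin τ (Set.Iio τ)) (nhds (w + τ • k)) :=
    hcont.continuousAt.tendsto.mono_left nhdsWithin_le_nhds
  have hev : ∀ᶠ t in nhdsWithin τ (Set.Iio τ), t ∈ Set.Ico 0 τ := by
    filter_upwards [Ioo_mem_nhdsLT hτ0] with t ht using ⟨ht.1.le, ht.2⟩
  have hevI : ∀ᶠ t in nhdsWithin τ (Set.Iio τ), w + t • k ∈ interior K := hev.mono seg
  have hfr : w + τ • k ∈ frontier K := by
    refine ⟨mem_closure_of_tendsto htend (hevI.mono fun t ht => interior_subset ht), hτB.2⟩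
  have hblow := (h.blowup _ hfr).comp
    (tendsto_nhdsWithin_iff.2 ⟨htend, hevI⟩)
  have gle := sc_upper (τ := τ) hτB.1.2 (g := fun t => der2 ψ (w + t • k) k k)
      (g' := fun t => der3 ψ (w + t • k) k)
      (fun t ht => line3 (scb_cd h (seg t ht)))
      (fun t ht => scb_nonneg h (seg t ht) k)
      (fun t ht => h.selfConc _ (seg t ht) k) (by simpa using hk)
  have mv : ∀ (f f' : ℝ → ℝ) (C : ℝ), (∀ t ∈ Set.Ico 0 τ, HasDerivAt f (f' t) t) →
      (∀ t ∈ Set.Ico 0 τ, |f' t| ≤ C) → ∀ t ∈ Set.Ico 0 τ, |f t - f 0| ≤ C := by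
    intro f f' C hd hC t ht
    have := (convex_Ico 0 τ).norm_image_sub_le_of_norm_hasDerivWithin_le
      (fun t ht => (hd t ht).hasDerivWithinAt) hC ⟨le_rfl, hτ0⟩ ht
    have hC0 : 0 ≤ C := (abs_nonneg _).trans (hC t ht)
    have ht1 : t ≤ 1 := ht.2.le.trans hτB.1.2
    rw [Real.norm_eq_abs, Real.norm_eq_abs, sub_zero, abs_of_nonneg ht.1] at this
    nlinarith
  have b1 := mv (fun t => der1 ψ (w + t • k) k) _ 1
    (fun t ht => line2 ((scb_cd h (seg t ht)).of_le (by norm_num)))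
    (fun t ht => by rw [abs_of_nonneg (scb_nonneg h (seg t ht) k)]; exact gle t ht)
  have b2 := mv (fun t => ψ (w + t • k)) _ (1 + |der1 ψ w k|)
    (fun t ht => line1 ((scb_cd h (seg t ht)).differentiableAt (by norm_num)))
    (fun t ht => by
      have := b1 t ht
      simp only [zero_smul, add_zero] at this
      have h3 := abs_sub_abs_le_abs_sub (der1 ψ (w + t • k) k) (der1 ψ w k)
      linarith)
  obtain ⟨t, ht1, ht2⟩ := ((hblow.eventually_gt_atTop (ψ w + (1 + |der1 ψ w k|))).and hev).exists
  have := (abs_le.1 (b2 t ht2)).2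
  simp only [zero_smul, add_zero] at this
  simp only [Function.comp] at ht1
  linarith

lemma hess_compare (hK : Convex ℝ K) (hKc : IsClosed K) (h : IsSCB K ψ ν) (hν : 1 ≤ ν)
    {w u x : Fin n → ℝ} {s δ : ℝ} (hw : w ∈ interior K) (hu : u ∈ K) (hδ : 0 < δ) (hs : 0 ≤ s) (hsδ : δ = 1 - s)
    (hx : x = w + s • (u - w)) :
    x ∈ interior K ∧ (∀ k, der2 ψ x k k ≤ (10 * ν / δ) ^ 2 * der2 ψ w k k) ∧
      der2 ψ x (w - x) (w - x) ≤ (5 * ν / δ) ^ 2 := by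
  have comb : ∀ a ∈ interior K, δ • a + s • u ∈ interior K := fun a ha =>
    hK.combo_interior_self_mem_interior ha hu hδ hs (by linarith)
  have hxi : x ∈ interior K := by
    have := comb w hw
    convert this using 1
    rw [hx, hsδ]; module
  have step : ∀ k, x + δ • k ∈ interior K → x - δ • k ∈ interior K →
      der2 ψ x k k ≤ (5 * ν / δ) ^ 2 := by
    intro k h1 h2
    have := factB hK h hν hxi h1 h2
    rw [der2_smul] at this
    rw [div_pow, le_div_iff₀ (by positivity)]; linarith
  refine ⟨hxi, fun k => ?_, ?_⟩
  · -- scaling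
    have hx0 := scb_nonneg h hxi k
    have hw0 := scb_nonneg h hw k
    have main : ∀ c : ℝ, 0 < c → c ^ 2 * der2 ψ w k k < 1 / 4 → c ^ 2 * der2 ψ x k k ≤ (5 * ν / δ) ^ 2 := by
      intro c hc hck
      rw [← der2_smul] at hck ⊢
      have d1 := comb _ (dikin hKc h hw hck)
      have d2 := comb _ (dikin hKc h hw (k := -(c • k)) (by rwa [der_neg]))
      apply step
      · convert d1 using 1
        rw [hx, hsδ]; module
      · convert d2 using 1
        rw [hx, hsδ]; module
    -- for all ε
    refine le_of_forall_pos_le_add fun ε hε => ?_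
    have hM : 0 < (10 * ν / δ) ^ 2 := by positivity
    set M := (10 * ν / δ) ^ 2 with hMd
    set q := der2 ψ w k k + ε / M with hq
    have hq0 : 0 < q := by positivity
    have hc := main (Real.sqrt (1 / (4 * q))) (Real.sqrt_pos.2 (by positivity)) (by
      rw [Real.sq_sqrt (by positivity), div_mul_eq_mul_div, div_lt_iff₀ (by positivity)]
      have : 0 < ε / M := by positivity
      linarith)
    rw [Real.sq_sqrt (by positivity), div_mul_eq_mul_div, div_le_iff₀ (by positivity)] at hc
    have e : (5 * ν / δ) ^ 2 * (4 * q) = M * q := by rw [hMd]; ring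
    rw [e, hq, mul_add, mul_div_cancel₀ _ hM.ne'] at hc
    linarith
  · apply step
    · have := hK.combo_interior_self_mem_interior hw (interior_subset hxi) hδ hs (by linarith)
      convert this using 1
      rw [hsδ]; module
    · have := hK.combo_interior_self_mem_interior (a := δ ^ 2) (b := s * (1 + δ)) hw hu (by positivity) (by positivity) (by rw [hsδ]; ring)
      convert this using 1
      rw [hx, hsδ]; module
end body

lemma quad_hess {n : ℕ} (f : (Fin n → ℝ) → ℝ) (x p : Fin n → ℝ) :
    dotp p ((hess f x).mulVec p) = der2 f x p p := by
  rw [der2_eq]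
  have hp : p = ∑ i, p i • (Pi.single i 1 : Fin n → ℝ) := by
    ext j; simp [Finset.sum_apply, Pi.single_apply]
  conv_rhs => rw [hp]
  simp only [map_sum, map_smul, _root_.sum_apply, _root_.smul_apply, dotp, hess, Matrix.mulVec,
    dotProduct, Matrix.of_apply, der2_eq, smul_eq_mul, Finset.mul_sum]
  rw [Finset.sum_comm]
  refine Finset.sum_congr rfl fun i _ => Finset.sum_congr rfl fun j _ => ?_
  ring

lemma lifted_cd {d : ℕ} {ψ : (Fin d → ℝ) → ℝ} {ν : ℝ} {w : Fin d → ℝ} (h : ContDiffAt ℝ 3 ψ w) :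
    ContDiffAt ℝ 3 (liftedBarrier ψ ν) (liftv w) := by
  have hl : (liftv w) (Fin.last d) = 1 := by simp [liftv]
  have e : (fun i : Fin d => liftv w i.castSucc / liftv w (Fin.last d)) = w := by
    ext i; simp [liftv]
  have h1 : ContDiffAt ℝ 3 (fun x : Fin (d + 1) → ℝ => fun i : Fin d => x i.castSucc / x (Fin.last d)) (liftv w) := by
    rw [contDiffAt_pi]
    intro i
    exact (contDiff_apply ℝ ℝ i.castSucc).contDiffAt.div (contDiff_apply ℝ ℝ (Fin.last d)).contDiffAt
      (by rw [hl]; norm_num)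
  have h2 : ContDiffAt ℝ 3 (fun x : Fin (d + 1) → ℝ => ψ (fun i : Fin d => x i.castSucc / x (Fin.last d))) (liftv w) :=
    ContDiffAt.comp (g := ψ) (liftv w) (by rw [e]; exact h) h1
  have h3 : ContDiffAt ℝ 3 (fun x : Fin (d + 1) → ℝ => Real.log (x (Fin.last d))) (liftv w) :=
    (contDiff_apply ℝ ℝ (Fin.last d)).contDiffAt.log (by rw [hl]; norm_num)
  exact contDiffAt_const.mul (h2.sub (contDiffAt_const.mul h3))

lemma lift_der2 {d : ℕ} {ψ : (Fin d → ℝ) → ℝ} {ν : ℝ} {w : Fin d → ℝ} (h : ContDiffAt ℝ 3 ψ w)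
    (p : Fin (d + 1) → ℝ) (β : ℝ) (hβ : β = p (Fin.last d)) (k : Fin d → ℝ)
    (hk : k = fun i => p i.castSucc - β * w i) :
    der2 (liftedBarrier ψ ν) (liftv w) p p =
      400 * (der2 ψ w k k - 2 * β * der1 ψ w k + 2 * ν * β ^ 2) := by
  have hcd := lifted_cd (ν := ν) h
  have hX : liftv w + (0:ℝ) • p = liftv w := by simp
  have L2 := line2 (f := liftedBarrier ψ ν) (x := liftv w) (h := p) (t := 0)
    (by rw [hX]; exact hcd.of_le (by norm_num))
  rw [hX] at L2
  have hpos : ∀ᶠ t : ℝ in nhds 0, 0 < 1 + t * β := by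
    have : ContinuousAt (fun t : ℝ => 1 + t * β) 0 := by fun_prop
    exact this.eventually (lt_mem_nhds (by simp))
  have hform : ∀ t : ℝ, 0 < 1 + t * β → liftedBarrier ψ ν (liftv w + t • p) =
      400 * (ψ (w + (t / (1 + t * β)) • k) - 2 * ν * Real.log (1 + t * β)) := by
    intro t ht
    unfold liftedBarrier
    have e1 : (liftv w + t • p) (Fin.last d) = 1 + t * β := by simp [liftv, hβ]
    have e2 : (fun i : Fin d => (liftv w + t • p) i.castSucc / (liftv w + t • p) (Fin.last d)) =
        w + (t / (1 + t * β)) • k := by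
      ext i
      rw [e1, hk]
      simp [liftv]
      field_simp
      ring
    rw [e2, e1]
  have hσ : ∀ t : ℝ, 0 < 1 + t * β → HasDerivAt (fun t : ℝ => t / (1 + t * β)) (1 / (1 + t * β) ^ 2) t := by
    intro t ht
    have := (hasDerivAt_id t).div (((hasDerivAt_id t).mul_const β).const_add 1) ht.ne'
    have e : (1 / (1 + t * β) ^ 2) = (1 * (1 + t * β) - t * (1 * β)) / (1 + t * β) ^ 2 := by ring
    rw [e]
    exact this
  have hlin : ∀ t : ℝ, HasDerivAt (fun t : ℝ => 1 + t * β) β t := by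
    intro t
    have := ((hasDerivAt_id t).mul_const β).const_add 1
    rw [one_mul] at this
    exact this
  have hσc : ContinuousAt (fun t : ℝ => w + (t / (1 + t * β)) • k) 0 :=
    continuousAt_const.add (((hσ 0 (by simp)).continuousAt).smul continuousAt_const)
  have hcdn : ∀ᶠ t : ℝ in nhds 0, ContDiffAt ℝ 3 ψ (w + (t / (1 + t * β)) • k) := by
    apply hσc.eventually
    simpa using h.eventually (by norm_num)
  have hXc : ContinuousAt (fun t : ℝ => liftv w + t • p) 0 := by fun_prop
  have hcdn2 : ∀ᶠ t : ℝ in nhds 0, ContDiffAt ℝ 3 (liftedBarrier ψ ν) (liftv w + t • p) := by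
    apply hXc.eventually
    simpa using hcd.eventually (by norm_num)
  have hD1 : ∀ᶠ t : ℝ in nhds 0, der1 (liftedBarrier ψ ν) (liftv w + t • p) p =
      400 * (der1 ψ (w + (t / (1 + t * β)) • k) k * (1 / (1 + t * β) ^ 2) - 2 * ν * (β / (1 + t * β))) := by
    filter_upwards [hpos, hcdn, hcdn2, hpos.eventually_nhds] with t h1 h2 h3 h4
    have a1 := line1 (f := liftedBarrier ψ ν) (x := liftv w) (h := p) (t := t)
      (h3.differentiableAt (by norm_num))
    have a2 := (line1 (f := ψ) (x := w) (h := k) (t := t / (1 + t * β))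
      (h2.differentiableAt (by norm_num))).comp t (hσ t h1)
    have a3 := (a2.sub (((hlin t).log h1.ne').const_mul (2 * ν))).const_mul 400
    exact a1.unique (a3.congr_of_eventuallyEq (h4.mono fun s hs => hform s hs))
  have b1 : HasDerivAt (fun t : ℝ => der1 ψ (w + (t / (1 + t * β)) • k) k) (der2 ψ w k k) 0 := by
    have q := line2 (f := ψ) (x := w) (h := k) (t := 0 / (1 + 0 * β))
      (by simpa using h.of_le (by norm_num))
    have := q.comp 0 (hσ 0 (by simp))
    simpa [Function.comp_def] using this
  have b2 : HasDerivAt (fun t : ℝ => 1 / (1 + t * β) ^ 2) (-2 * β) 0 := by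
    have := ((hlin 0).pow 2).inv (by simp)
    simp only [one_div]
    exact this.congr_deriv (by norm_num)
  have b3 : HasDerivAt (fun t : ℝ => β / (1 + t * β)) (- β ^ 2) 0 := by
    have := (hasDerivAt_const 0 β).div (hlin 0) (by simp)
    exact this.congr_deriv (by norm_num; ring)
  have b4 := ((b1.mul b2).sub (b3.const_mul (2 * ν))).const_mul 400
  have := L2.unique (b4.congr_of_eventuallyEq hD1)
  rw [this]
  simp
  ring

lemma lift_der2_bounds {d : ℕ} {K : Set (Fin d → ℝ)} {ψ : (Fin d → ℝ) → ℝ} {ν : ℝ} (hψ : IsSCB K ψ ν) (hν : 1 ≤ ν)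
    {w : Fin d → ℝ} (hw : w ∈ interior K)
    (p : Fin (d + 1) → ℝ) (β : ℝ) (hβ : β = p (Fin.last d)) (k : Fin d → ℝ)
    (hk : k = fun i => p i.castSucc - β * w i) :
    400 / 3 * (der2 ψ w k k + ν * β ^ 2) ≤ der2 (liftedBarrier ψ ν) (liftv w) p p ∧
    der2 (liftedBarrier ψ ν) (liftv w) p p ≤ 1200 * (der2 ψ w k k + ν * β ^ 2) := by
  rw [lift_der2 (scb_cd hψ hw) p β hβ k hk]
  have h1 := abs_le.1 (hψ.gradBound w hw k)
  have h0 := scb_nonneg hψ hw k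
  obtain ⟨a, ha⟩ : ∃ a, a = √(der2 ψ w k k) := ⟨_, rfl⟩
  obtain ⟨m, hm⟩ : ∃ m, m = √ν := ⟨_, rfl⟩
  have ha2 : a ^ 2 = der2 ψ w k k := by rw [ha, Real.sq_sqrt h0]
  have hm2 : m ^ 2 = ν := by rw [hm, Real.sq_sqrt (by linarith)]
  rw [← ha, ← hm] at h1
  rw [← ha2, ← hm2]
  set g := der1 ψ w k
  have hb : |β * g| ≤ |m * β * a| := by
    have hm0 : 0 ≤ m := hm ▸ Real.sqrt_nonneg _
    have ha0 : 0 ≤ a := ha ▸ Real.sqrt_nonneg _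
    rw [abs_mul, abs_mul, abs_mul, abs_of_nonneg hm0, abs_of_nonneg ha0]
    have : |g| ≤ m * a := abs_le.2 h1
    calc |β| * |g| ≤ |β| * (m * a) := by gcongr
      _ = _ := by ring
  have hsq : |m * β * a| = |m * β| * |a| := abs_mul _ _
  have s1 : |a| ^ 2 = a ^ 2 := sq_abs a
  have s2 : |m * β| ^ 2 = m ^ 2 * β ^ 2 := by rw [sq_abs]; ring
  have hb' := abs_le.1 hb
  rw [hsq] at hb'
  constructor
  · nlinarith [sq_nonneg (2 * |a| - 3 * |m * β|), sq_nonneg (|m * β|)]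
  · nlinarith [sq_nonneg (|a| - |m * β|), sq_nonneg a]

/-- comparison of lifted Hessians -/
lemma lift_compare {d : ℕ} {K : Set (Fin d → ℝ)} {ψ : (Fin d → ℝ) → ℝ} {ν : ℝ} (hK : Convex ℝ K) (hKc : IsClosed K)
    (hψ : IsSCB K ψ ν) (hν : 1 ≤ ν) {w u x : Fin d → ℝ} {s δ : ℝ} (hw : w ∈ interior K) (hu : u ∈ K)
    (hδ : 0 < δ) (hs : 0 ≤ s) (hsδ : δ = 1 - s) (hx : x = w + s • (u - w)) (p : Fin (d + 1) → ℝ) :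
    der2 (liftedBarrier ψ ν) (liftv x) p p ≤
      1809 * (ν / δ) ^ 2 * der2 (liftedBarrier ψ ν) (liftv w) p p := by
  obtain ⟨hxi, c1, c2⟩ := hess_compare hK hKc hψ hν hw hu hδ hs hsδ hx
  set β := p (Fin.last d) with hβ
  set k : Fin d → ℝ := fun i => p i.castSucc - β * w i with hk
  set k' : Fin d → ℝ := fun i => p i.castSucc - β * x i with hk'
  have hkk : k' = k + β • (w - x) := by
    ext i; simp [hk, hk']; ring
  have u1 := (lift_der2_bounds hψ hν hxi p β hβ k' hk').2
  have l1 := (lift_der2_bounds hψ hν hw p β hβ k hk).1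
  have par : ∀ a b : Fin d → ℝ, der2 ψ x (a + b) (a + b) ≤ 2 * der2 ψ x a a + 2 * der2 ψ x b b := by
    intro a b
    have h1 := scb_nonneg hψ hxi (a - b)
    simp only [der2_eq, map_add, map_sub, _root_.add_apply, _root_.sub_apply] at h1 ⊢
    linarith
  have h2 := par k (β • (w - x))
  rw [← hkk, der2_smul] at h2
  have h3 := c1 k
  have h0 := scb_nonneg hψ hw k
  have hν2 : (ν / δ) ^ 2 ≥ 1 := by
    have : 1 ≤ ν / δ := by rw [le_div_iff₀ hδ]; linarith
    nlinarith
  set N := (ν / δ) ^ 2 with hN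
  have e1 : (10 * ν / δ) ^ 2 = 100 * N := by rw [hN]; ring
  have e2 : (5 * ν / δ) ^ 2 = 25 * N := by rw [hN]; ring
  rw [e1] at h3
  rw [e2] at c2
  have h4 : β ^ 2 * der2 ψ x (w - x) (w - x) ≤ β ^ 2 * (25 * N) := by gcongr
  have h5 : der2 ψ x k' k' + ν * β ^ 2 ≤ 201 * N * (der2 ψ w k k + ν * β ^ 2) := by
    have h6 : β ^ 2 ≤ ν * β ^ 2 := by nlinarith [sq_nonneg β]
    have h7 : N * β ^ 2 ≤ N * (ν * β ^ 2) := by gcongr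
    have h8 : 1 * (ν * β ^ 2) ≤ N * (ν * β ^ 2) := by gcongr
    have h9 : 0 ≤ N * der2 ψ w k k := by positivity
    have h10 : 0 ≤ N * (ν * β ^ 2) := by positivity
    nlinarith
  have h6 : N * (400 / 3 * (der2 ψ w k k + ν * β ^ 2)) ≤ N * der2 (liftedBarrier ψ ν) (liftv w) p p := by gcongr
  nlinarith

lemma liftv_cont {d : ℕ} : Continuous (liftv : (Fin d → ℝ) → Fin (d + 1) → ℝ) := by
  rw [continuous_pi_iff]
  intro i
  refine Fin.lastCases ?_ (fun j => ?_) i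
  · simp [liftv, continuous_const]
  · simpa [liftv] using continuous_apply j

lemma boundary_zero {d : ℕ} {K : Set (Fin d → ℝ)} {ψ : (Fin d → ℝ) → ℝ} {ν : ℝ} (hK : Convex ℝ K)
    (hint : (interior K).Nonempty)
    (hψ : IsSCB K ψ ν) {w : Fin d → ℝ} (hw : w ∈ K) (hwi : w ∉ interior K) (p : Fin (d + 1) → ℝ) :
    der2 (liftedBarrier ψ ν) (liftv w) p p = 0 := by
  rw [der2_eq]
  by_cases hdiff : DifferentiableAt ℝ (fderiv ℝ (liftedBarrier ψ ν)) (liftv w)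
  swap
  · rw [fderiv_zero_of_not_differentiableAt hdiff]; simp
  exfalso
  set M := ‖fderiv ℝ (liftedBarrier ψ ν) (liftv w)‖ + 1 with hM
  have hc : ContinuousAt (fun y => ‖fderiv ℝ (liftedBarrier ψ ν) (liftv y)‖) w :=
    (ContinuousAt.comp (g := fderiv ℝ (liftedBarrier ψ ν)) hdiff.continuousAt liftv_cont.continuousAt).norm
  have hev : ∀ᶠ y in nhds w, ‖fderiv ℝ (liftedBarrier ψ ν) (liftv y)‖ < M :=
    hc.eventually (gt_mem_nhds (by simp [hM]))
  obtain ⟨r, hr, hball⟩ := Metric.eventually_nhds_iff_ball.1 hev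
  set V := Metric.ball w r ∩ interior K with hV
  have hVc : Convex ℝ V := (convex_ball w r).inter hK.interior
  have hsc : Convex ℝ (liftv '' V) := by
    rintro _ ⟨a, ha, rfl⟩ _ ⟨b, hb, rfl⟩ s t hs ht hst
    refine ⟨s • a + t • b, hVc ha hb hs ht hst, ?_⟩
    ext i
    refine Fin.lastCases ?_ (fun j => ?_) i
    · simp [liftv, hst]
    · simp [liftv]
  have hcl : w ∈ closure (interior K) := by
    rw [hK.closure_interior_eq_closure_of_nonempty_interior hint]
    exact subset_closure hw
  have hne : (nhdsWithin w (interior K)).NeBot := mem_closure_iff_nhdsWithin_neBot.1 hcl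
  have hVm : ∀ᶠ y in nhdsWithin w (interior K), y ∈ V := by
    filter_upwards [self_mem_nhdsWithin, nhdsWithin_le_nhds (Metric.ball_mem_nhds w hr)] with y h1 h2
      using ⟨h2, h1⟩
  obtain ⟨y0, hy0⟩ := hVm.exists
  have hlv : ∀ y, liftedBarrier ψ ν (liftv y) = 400 * ψ y := by
    intro y; simp [liftedBarrier, liftv]
  have hfr : w ∈ frontier K := ⟨subset_closure hw, hwi⟩
  have hlb : Filter.Tendsto (fun y => ‖liftv y - liftv y0‖) (nhdsWithin w (interior K))
      (nhds ‖liftv w - liftv y0‖) :=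
    ((liftv_cont.sub continuous_const).norm.tendsto w).mono_left nhdsWithin_le_nhds
  have hev2 := hlb.eventually (gt_mem_nhds (lt_add_one _))
  have hev3 := (hψ.blowup w hfr).eventually_gt_atTop
    ((400 * ψ y0 + M * (‖liftv w - liftv y0‖ + 1)) / 400)
  obtain ⟨y, hyV, hy2, hy3⟩ := (hVm.and (hev2.and hev3)).exists
  have key := hsc.norm_image_sub_le_of_norm_fderiv_le (f := liftedBarrier ψ ν) (C := M) (𝕜 := ℝ)
    (by
      rintro _ ⟨a, ha, rfl⟩
      exact (lifted_cd (scb_cd hψ ha.2)).differentiableAt (by norm_num))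
    (by
      rintro _ ⟨a, ha, rfl⟩
      exact (hball a ha.1).le) (Set.mem_image_of_mem _ hy0) (Set.mem_image_of_mem _ hyV)
  rw [hlv, hlv, Real.norm_eq_abs] at key
  have k2 := (le_abs_self _).trans key
  have hM0 : 0 < M := by positivity
  have k3 : M * ‖liftv y - liftv y0‖ ≤ M * (‖liftv w - liftv y0‖ + 1) := by gcongr
  linarith

lemma one_le_prod_aux {ι : Type*} {s : Finset ι} {f : ι → ℝ} (h : ∀ i ∈ s, 1 ≤ f i) : 1 ≤ ∏ i ∈ s, f i := by
  calc (1:ℝ) = ∏ _i ∈ s, (1:ℝ) := by simp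
    _ ≤ _ := Finset.prod_le_prod (fun _ _ => by norm_num) h

lemma psd_spec {m : ℕ} (M : Matrix (Fin m) (Fin m) ℝ) (hM : M.PosSemidef) :
    ∃ l : Fin m → ℝ, (∀ i, 0 ≤ l i) ∧ (1 + M).det = ∏ i, (1 + l i) ∧
      ∀ c : ℝ, (∀ i, l i ≤ c) → ∀ q : Fin m → ℝ, q ⬝ᵥ (M *ᵥ q) ≤ c * (q ⬝ᵥ q) := by
  set l := hM.1.eigenvalues with hl
  set U : Matrix (Fin m) (Fin m) ℝ := (hM.1.eigenvectorUnitary : Matrix (Fin m) (Fin m) ℝ) with hU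
  have hUU : U * star U = 1 := Unitary.coe_mul_star_self _
  have hspec : M = U * diagonal l * star U := by
    have := hM.1.spectral_theorem
    rw [Unitary.conjStarAlgAut_apply] at this
    exact this
  refine ⟨l, fun i => hM.eigenvalues_nonneg i, ?_, ?_⟩
  · have e : 1 + M = U * (diagonal (fun i => 1 + l i)) * star U := by
      have : (diagonal (fun i => 1 + l i)) = (1 : Matrix (Fin m) (Fin m) ℝ) + diagonal l := by
        rw [← diagonal_one, diagonal_add]
      rw [this, mul_add, add_mul, mul_one, hUU, ← hspec]
    rw [e, det_mul, det_mul, mul_right_comm, ← det_mul, hUU, det_one, one_mul, det_diagonal]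
  · intro c hc q
    have e : c • (1 : Matrix (Fin m) (Fin m) ℝ) - M = U * (diagonal (fun i => c - l i)) * Uᴴ := by
      have : (diagonal (fun i => c - l i)) = c • (1 : Matrix (Fin m) (Fin m) ℝ) - diagonal l := by
        rw [← diagonal_one, ← diagonal_smul, diagonal_sub]; congr 1; ext i; simp
      rw [this, mul_sub, sub_mul, Matrix.mul_smul, mul_one, Matrix.smul_mul, ← star_eq_conjTranspose, hUU, ← hspec]
    have hp : (c • (1 : Matrix (Fin m) (Fin m) ℝ) - M).PosSemidef := by
      rw [e]
      exact (PosSemidef.diagonal (fun i => sub_nonneg.2 (hc i))).mul_mul_conjTranspose_same U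
    have := hp.dotProduct_mulVec_nonneg q
    rw [sub_mulVec, smul_mulVec, one_mulVec, dotProduct_sub, dotProduct_smul] at this
    simp only [star_trivial, smul_eq_mul] at this
    linarith

open scoped MatrixOrder in
lemma posdef_factor {m : ℕ} (A : Matrix (Fin m) (Fin m) ℝ) (hA : A.PosDef) :
    ∃ C : Matrix (Fin m) (Fin m) ℝ, IsUnit C.det ∧ A = Cᴴ * C := by
  obtain ⟨X, hX, -, hXX⟩ := CFC.exists_sqrt_of_isSelfAdjoint_of_quasispectrumRestricts hA.1
          (QuasispectrumRestricts.nnreal_of_nonneg hA.posSemidef.nonneg)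
  have hX' : Xᴴ = X := hX
  refine ⟨X, ?_, by rw [hX', ← hXX]⟩
  have := hA.det_pos
  rw [← hXX, det_mul] at this
  exact isUnit_iff_ne_zero.2 (fun h => by simp [h] at this)

lemma det_add_spec {m : ℕ} (A B : Matrix (Fin m) (Fin m) ℝ) (hA : A.PosDef) (hB : B.PosSemidef) :
    ∃ l : Fin m → ℝ, (∀ i, 0 ≤ l i) ∧ (A + B).det = A.det * ∏ i, (1 + l i) ∧
      ∀ c : ℝ, (∀ i, l i ≤ c) → ∀ q : Fin m → ℝ, q ⬝ᵥ (B *ᵥ q) ≤ c * (q ⬝ᵥ (A *ᵥ q)) := by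
  obtain ⟨C, hC, hAC⟩ := posdef_factor A hA
  obtain ⟨l, hl0, hl1, hl2⟩ := psd_spec _ (hB.conjTranspose_mul_mul_same C⁻¹)
  set M := (C⁻¹)ᴴ * B * C⁻¹ with hM
  have e1 : C⁻¹ * C = 1 := nonsing_inv_mul C hC
  have e2 : Cᴴ * (C⁻¹)ᴴ = 1 := by rw [← conjTranspose_mul, e1, conjTranspose_one]
  have hBM : B = Cᴴ * M * C := by
    have : Cᴴ * M * C = (Cᴴ * (C⁻¹)ᴴ) * B * (C⁻¹ * C) := by rw [hM]; simp only [mul_assoc]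
    rw [this, e1, e2, one_mul, mul_one]
  have conj : ∀ (N : Matrix (Fin m) (Fin m) ℝ) (q : Fin m → ℝ),
      q ⬝ᵥ ((Cᴴ * N * C) *ᵥ q) = (C *ᵥ q) ⬝ᵥ (N *ᵥ (C *ᵥ q)) := by
    intro N q
    rw [← mulVec_mulVec, ← mulVec_mulVec, dotProduct_mulVec, conjTranspose_eq_transpose_of_trivial, vecMul_transpose]
  refine ⟨l, hl0, ?_, ?_⟩
  · have : A + B = Cᴴ * (1 + M) * C := by
      rw [mul_add, add_mul, mul_one, ← hAC, ← hBM]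
    rw [this, det_mul, det_mul, hl1, hAC, det_mul]; ring
  · intro c hc q
    have hA1 : A = Cᴴ * 1 * C := by rw [mul_one, hAC]
    rw [hBM, hA1, conj, conj, one_mulVec]
    exact hl2 c hc _

lemma det_mono {m : ℕ} (A B : Matrix (Fin m) (Fin m) ℝ) (hA : A.PosDef) (hB : B.PosSemidef) :
    A.det ≤ (A + B).det := by
  obtain ⟨l, h0, h1, -⟩ := det_add_spec A B hA hB
  rw [h1]
  have : 1 ≤ ∏ i, (1 + l i) := one_le_prod_aux fun i _ => by linarith [h0 i]
  nlinarith [hA.det_pos]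

lemma det_double {m : ℕ} (A B : Matrix (Fin m) (Fin m) ℝ) (hA : A.PosDef) (hB : B.PosSemidef)
    (q : Fin m → ℝ) (hq : q ⬝ᵥ (A *ᵥ q) < q ⬝ᵥ (B *ᵥ q)) :
    2 * A.det ≤ (A + B).det := by
  obtain ⟨l, h0, h1, h2⟩ := det_add_spec A B hA hB
  have : ∃ i, 1 < l i := by
    by_contra! hc
    have := h2 1 hc q
    linarith
  obtain ⟨i, hi⟩ := this
  rw [h1]
  have h3 : 2 ≤ ∏ i, (1 + l i) := by
    rw [← Finset.mul_prod_erase _ _ (Finset.mem_univ i)]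
    have : 1 ≤ ∏ j ∈ Finset.univ.erase i, (1 + l j) := one_le_prod_aux fun i _ => by linarith [h0 i]
    nlinarith
  nlinarith [hA.det_pos]

lemma dotp_eq {n : ℕ} (x y : Fin n → ℝ) : dotp x y = x ⬝ᵥ y := rfl

lemma exp_inv_log_two_le : Real.exp (1 / Real.log 2) ≤ 5 := by
  have h1 : 1 / Real.log 2 ≤ 1 + 0.45 := by
    rw [div_le_iff₀ (Real.log_pos (by norm_num))]
    linarith [Real.log_two_gt_d9]
  have h2 : Real.exp 0.45 ≤ 1 / 0.55 := by
    have := Real.add_one_le_exp (-0.45)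
    rw [Real.exp_neg] at this
    rw [le_div_iff₀ (by norm_num)]
    have hp := Real.exp_pos 0.45
    calc Real.exp 0.45 * 0.55 ≤ Real.exp 0.45 * (Real.exp 0.45)⁻¹ := by
          gcongr; linarith
      _ = 1 := mul_inv_cancel₀ hp.ne'
  calc Real.exp (1 / Real.log 2) ≤ Real.exp (1 + 0.45) := Real.exp_le_exp.2 h1
    _ = Real.exp 1 * Real.exp 0.45 := Real.exp_add _ _
    _ ≤ 2.7182818286 * (1 / 0.55) := by
      gcongr
      exact Real.exp_one_lt_d9.le
    _ ≤ 5 := by norm_num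

/-- **Lemma B.9: bound on the number of learning-rate increases.**
Assume `T ≥ 8`.  In Algorithm 2 (SCRiBLe-style mirror descent with the lifted
`800ν`-normal barrier and the eigenvalue-triggered increasing learning-rate schedule
with `κ = e^{1/(100 d ln(νT))}`), the number `n` of times the learning rate is
increased over `T` rounds satisfies `n ≤ 100 d log₂(νT)`; consequently
`η_t ≤ κ^n η ≤ 5 η` for all `t ∈ [T]`. -/
theorem number_of_learning_rate_increases
    (d T : ℕ) (hd : 1 ≤ d) (hT : 8 ≤ T) (ν η : ℝ) (hν : 1 ≤ ν) (hη : 0 < η)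
    (Ωs : Set (Fin d → ℝ)) (hconv : Convex ℝ Ωs) (hcomp : IsCompact Ωs)
    (hint : (interior Ωs).Nonempty)
    (ψ : (Fin d → ℝ) → ℝ) (hψ : IsSCB Ωs ψ ν)
    (ℓv : ℕ → Fin d → ℝ) (hℓ : ∀ t ∈ Finset.Icc 1 T, ∀ w ∈ Ωs, |dotp w (ℓv t)| ≤ 1)
    (sv wp : ℕ → Fin (d + 1) → ℝ)
    (R : ℕ → Matrix (Fin (d + 1)) (Fin (d + 1)) ℝ)
    (ηv : ℕ → ℝ) (S : ℕ → Finset ℕ)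
    -- abbreviations
    (Ψ : (Fin (d + 1) → ℝ) → ℝ) (hΨ : Ψ = liftedBarrier ψ ν)
    (Ωp : Set (Fin (d + 1) → ℝ)) (hΩp : Ωp = liftv '' Ωs)
    (H : ℕ → Matrix (Fin (d + 1)) (Fin (d + 1)) ℝ) (hH : ∀ t, H t = hess Ψ (wp t))
    (elast : Fin (d + 1) → ℝ) (helast : elast = Pi.single (Fin.last d) 1)
    (lp : ℕ → Fin (d + 1) → ℝ) (hlp : ∀ t, lp t = Fin.snoc (ℓv t) 0)
    (wt : ℕ → Fin (d + 1) → ℝ) (hwt : ∀ t, wt t = wp t + (R t)⁻¹.mulVec (sv t))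
    (lh : ℕ → Fin (d + 1) → ℝ)
    (hlh : ∀ t, lh t = ((d : ℝ) * dotp (wt t) (lp t)) • (R t).mulVec (sv t))
    (Ωp' : Set (Fin (d + 1) → ℝ))
    (hΩp' : Ωp' = {x ∈ Ωp | mink Ωp (wp 1) x ≤ 1 - 1 / (T : ℝ)})
    -- Algorithm 2
    (hinit : wp 1 ∈ Ωp ∧ ∀ y ∈ Ωp, Ψ (wp 1) ≤ Ψ y)
    (hR : ∀ t ∈ Finset.Icc 1 (T + 1), (R t).PosDef ∧ (R t).IsSymm ∧ R t * R t = H t)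
    (hs : ∀ t ∈ Finset.Icc 1 T,
      dotp (sv t) (sv t) = 1 ∧ dotp (sv t) ((R t)⁻¹.mulVec elast) = 0)
    (hupd : ∀ t ∈ Finset.Icc 1 T, wp (t + 1) ∈ Ωp' ∧ ∀ y ∈ Ωp',
      dotp (wp (t + 1)) (lh t) + (1 / ηv t) * breg Ψ (wp (t + 1)) (wp t)
        ≤ dotp y (lh t) + (1 / ηv t) * breg Ψ y (wp t))
    (hη1 : ηv 1 = η) (hS1 : S 1 = {1})
    (hsch : ∀ t ∈ Finset.Icc 1 T,
      ((∃ p : Fin (d + 1) → ℝ,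
          0 < dotp p ((H (t + 1) - ∑ τ ∈ S t, H τ).mulVec p)) →
        S (t + 1) = insert (t + 1) (S t) ∧
        ηv (t + 1) = Real.exp (1 / (100 * d * Real.log (ν * T))) * ηv t) ∧
      (¬ (∃ p : Fin (d + 1) → ℝ,
          0 < dotp p ((H (t + 1) - ∑ τ ∈ S t, H τ).mulVec p)) →
        S (t + 1) = S t ∧ ηv (t + 1) = ηv t)) :
    ((S (T + 1)).card : ℝ) - 1 ≤ 100 * d * Real.logb 2 (ν * T) ∧
    ∀ t ∈ Finset.Icc 1 T,
      ηv t ≤ Real.exp (1 / (100 * d * Real.log (ν * T))) ^ ((S (T + 1)).card - 1) * η ∧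
      Real.exp (1 / (100 * d * Real.log (ν * T))) ^ ((S (T + 1)).card - 1) * η ≤ 5 * η := by
  -- setup
  have hKc : IsClosed Ωs := hcomp.isClosed
  have hTR : (8:ℝ) ≤ T := by exact_mod_cast hT
  obtain ⟨N, hN⟩ : ∃ N : ℝ, N = ν * T := ⟨_, rfl⟩
  have hN8 : 8 ≤ N := by rw [hN]; nlinarith
  have hTN : (T:ℝ) ≤ N := by rw [hN]; nlinarith
  have hHpd : ∀ t ∈ Finset.Icc 1 (T + 1), (H t).PosDef := by
    intro t ht
    obtain ⟨h1, -, h3⟩ := hR t ht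
    rw [← h3]
    have e : (R t)ᴴ = R t := h1.1
    have := Matrix.PosDef.conjTranspose_mul_self (R t)
      (Matrix.mulVec_injective_of_isUnit h1.isUnit)
    rwa [e] at this
  have h1mem : (1:ℕ) ∈ Finset.Icc 1 (T + 1) := by simp
  have hH1 := hHpd 1 h1mem
  have hquad : ∀ t p, p ⬝ᵥ (H t *ᵥ p) = der2 Ψ (wp t) p p := by
    intro t p
    rw [hH, ← quad_hess]; rfl
  obtain ⟨w, hwK, hww⟩ : ∃ w ∈ Ωs, liftv w = wp 1 := by
    have := hinit.1
    rw [hΩp] at this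
    exact this
  have hwi : w ∈ interior Ωs := by
    by_contra hc
    have hz := boundary_zero hconv hint hψ hwK hc elast
    rw [hww, ← hΨ, ← hquad] at hz
    have hne : elast ≠ 0 := by
      rw [helast]; intro h0
      have := congrFun h0 (Fin.last d)
      simp at this
    have := hH1.dotProduct_mulVec_pos hne
    rw [star_trivial, hz] at this
    exact lt_irrefl _ this
  -- comparison of Hessians
  have hcmp : ∀ t ∈ Finset.Icc 1 (T + 1), ∀ p, p ⬝ᵥ (H t *ᵥ p) ≤ N ^ 7 * (p ⬝ᵥ (H 1 *ᵥ p)) := by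
    intro t ht p
    have hp0 : 0 ≤ p ⬝ᵥ (H 1 *ᵥ p) := by
      simpa using hH1.posSemidef.dotProduct_mulVec_nonneg p
    rcases Nat.eq_or_lt_of_le (Finset.mem_Icc.1 ht).1 with h1 | h1
    · rw [← h1]
      have : 1 ≤ N ^ 7 := one_le_pow₀ (by linarith)
      nlinarith
    · obtain ⟨t', rfl⟩ : ∃ t', t = t' + 1 := ⟨t - 1, by omega⟩
      have ht' : t' ∈ Finset.Icc 1 T := by
        rw [Finset.mem_Icc] at ht ⊢; omega
      have hm := (hupd t' ht').1
      rw [hΩp'] at hm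
      obtain ⟨hm1, hm2⟩ := hm
      have hm1' := hm1
      rw [hΩp] at hm1'
      obtain ⟨x, hxK, hxx⟩ := hm1'
      have hTi : 0 < 1 / (T:ℝ) := by positivity
      have hlt : mink Ωp (wp 1) (wp (t' + 1)) < 1 - 1 / (2 * (T:ℝ)) := by
        have : 1 / (2 * (T:ℝ)) = 1 / (T:ℝ) / 2 := by rw [div_div, mul_comm]
        linarith
      have hne : {s : ℝ | 0 < s ∧ wp 1 + s⁻¹ • (wp (t' + 1) - wp 1) ∈ Ωp}.Nonempty :=
        ⟨1, by norm_num, by simpa using hm1⟩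
      obtain ⟨s, ⟨hs0, hsm⟩, hs1⟩ := exists_lt_of_csInf_lt hne hlt
      rw [hΩp] at hsm
      obtain ⟨u, huK, huu⟩ := hsm
      have hxu : x = w + s • (u - w) := by
        ext i
        have := congrFun huu i.castSucc
        rw [← hww, ← hxx] at this
        simp [liftv] at this
        simp only [Pi.add_apply, Pi.smul_apply, Pi.sub_apply, smul_eq_mul]
        rw [this]
        field_simp
        ring
      have hT2 : 0 < 1 / (2 * (T:ℝ)) := by positivity
      have hδ : 0 < 1 - s := by linarith
      have key := lift_compare hconv hKc hψ hν hwi huK hδ hs0.le rfl hxu p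
      rw [hxx, hww, ← hΨ, ← hquad, ← hquad] at key
      refine key.trans ?_
      gcongr
      have hle : ν / (1 - s) ≤ 2 * N := by
        rw [div_le_iff₀ hδ, hN]
        have : 1 / (2 * (T:ℝ)) ≤ 1 - s := by linarith
        rw [div_le_iff₀ (by positivity)] at this
        nlinarith
      have hq0 : 0 ≤ ν / (1 - s) := by positivity
      calc 1809 * (ν / (1 - s)) ^ 2 ≤ 1809 * (2 * N) ^ 2 := by gcongr
        _ = 7236 * N ^ 2 := by ring
        _ ≤ 8 ^ 5 * N ^ 2 := by gcongr; norm_num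
        _ ≤ N ^ 5 * N ^ 2 := by gcongr
        _ = N ^ 7 := by ring
  obtain ⟨κ, hκ⟩ : ∃ κ : ℝ, κ = Real.exp (1 / (100 * d * Real.log (ν * T))) := ⟨_, rfl⟩
  rw [← hκ] at hsch ⊢
  have hdR : (1:ℝ) ≤ d := by exact_mod_cast hd
  have hlogN : 0 < Real.log N := Real.log_pos (by linarith)
  have hκ1 : 1 ≤ κ := by
    rw [hκ, ← hN]
    apply Real.one_le_exp; positivity
  have hsumpd : ∀ s : Finset ℕ, 1 ∈ s → s ⊆ Finset.Icc 1 (T + 1) → (∑ τ ∈ s, H τ).PosDef := by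
    intro s h1 hs
    rw [← Finset.add_sum_erase _ _ h1]
    exact hH1.add_posSemidef (Matrix.posSemidef_sum _ fun τ hτ =>
      (hHpd τ (hs (Finset.mem_of_mem_erase hτ))).posSemidef)
  have inv : ∀ k, k ≤ T → 1 ∈ S (k + 1) ∧ S (k + 1) ⊆ Finset.Icc 1 (k + 1) ∧
      ηv (k + 1) = κ ^ ((S (k + 1)).card - 1) * η ∧
      2 ^ ((S (k + 1)).card - 1) * (H 1).det ≤ (∑ τ ∈ S (k + 1), H τ).det := by
    intro k
    induction k with
    | zero =>
      intro _
      simp [hS1, hη1]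
    | succ k ih =>
      intro hk
      obtain ⟨i1, i2, i3, i4⟩ := ih (by omega)
      have hkm : k + 1 ∈ Finset.Icc 1 T := Finset.mem_Icc.2 ⟨by omega, hk⟩
      obtain ⟨s1, s2⟩ := hsch (k + 1) hkm
      have hsub : Finset.Icc 1 (k + 1) ⊆ Finset.Icc 1 (k + 1 + 1) :=
        Finset.Icc_subset_Icc le_rfl (by omega)
      by_cases hp : ∃ p : Fin (d + 1) → ℝ,
          0 < dotp p ((H (k + 1 + 1) - ∑ τ ∈ S (k + 1), H τ).mulVec p)
      · obtain ⟨e1, e2⟩ := s1 hp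
        obtain ⟨p, hp⟩ := hp
        have hnot : k + 1 + 1 ∉ S (k + 1) := fun h => by
          have := Finset.mem_Icc.1 (i2 h); omega
        have hcard : 1 ≤ (S (k + 1)).card := Finset.card_pos.2 ⟨1, i1⟩
        have hc2 : (S (k + 1 + 1)).card - 1 = ((S (k + 1)).card - 1) + 1 := by
          rw [e1, Finset.card_insert_of_notMem hnot]; omega
        refine ⟨by rw [e1]; exact Finset.mem_insert_of_mem i1, ?_, ?_, ?_⟩
        · rw [e1]
          exact Finset.insert_subset (by simp) (i2.trans hsub)
        · rw [e2, i3, hc2]; ring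
        · rw [hc2, e1, Finset.sum_insert hnot, add_comm (H (k + 1 + 1))]
          rw [dotp_eq, Matrix.sub_mulVec, dotProduct_sub] at hp
          have hpd := hsumpd _ i1 (i2.trans (Finset.Icc_subset_Icc le_rfl (by omega)))
          have := det_double _ (H (k + 1 + 1)) hpd
            (hHpd _ (Finset.mem_Icc.2 ⟨by omega, by omega⟩)).posSemidef p (by linarith)
          rw [pow_succ]
          linarith
      · obtain ⟨e1, e2⟩ := s2 hp
        rw [e1, e2]
        exact ⟨i1, i2.trans hsub, i3, i4⟩
  have hmono : ∀ k, 1 ≤ k → k ≤ T + 1 → ∀ j, 1 ≤ j → j ≤ k → S j ⊆ S k := by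
    intro k hk
    induction k, hk using Nat.le_induction with
    | base =>
      intro _ j h1 h2
      have : j = 1 := by omega
      rw [this]
    | succ k hk ih =>
      intro hkT j h1 h2
      have hstep : S k ⊆ S (k + 1) := by
        obtain ⟨s1, s2⟩ := hsch k (Finset.mem_Icc.2 ⟨hk, by omega⟩)
        by_cases hp : ∃ p : Fin (d + 1) → ℝ, 0 < dotp p ((H (k + 1) - ∑ τ ∈ S k, H τ).mulVec p)
        · rw [(s1 hp).1]; exact Finset.subset_insert _ _
        · rw [(s2 hp).1]
      rcases Nat.eq_or_lt_of_le h2 with e | e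
      · rw [e]
      · exact (ih (by omega) j h1 (by omega)).trans hstep
  obtain ⟨f1, f2, -, f4⟩ := inv T le_rfl
  have hcardT : (S (T + 1)).card ≤ T + 1 := by
    simpa using Finset.card_le_card f2
  have hcard1 : 1 ≤ (S (T + 1)).card := Finset.card_pos.2 ⟨1, f1⟩
  obtain ⟨n, hn⟩ : ∃ n, n = (S (T + 1)).card - 1 := ⟨_, rfl⟩
  rw [← hn] at f4 ⊢
  have hnR : ((S (T + 1)).card : ℝ) - 1 = n := by
    rw [hn, Nat.cast_sub hcard1]; simp
  rw [hnR, ← hN]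
  have hApd := hsumpd _ f1 f2
  have hpsd : (N ^ 9 • H 1 - ∑ τ ∈ S (T + 1), H τ).PosSemidef := by
    refine Matrix.PosSemidef.of_dotProduct_mulVec_nonneg ?_ fun q => ?_
    · exact (hH1.posSemidef.smul (by positivity : (0:ℝ) ≤ N ^ 9)).1.sub hApd.1
    · rw [star_trivial, Matrix.sub_mulVec, dotProduct_sub, Matrix.smul_mulVec, dotProduct_smul,
        Matrix.sum_mulVec, dotProduct_sum, sub_nonneg]
      have hq0 : 0 ≤ q ⬝ᵥ (H 1 *ᵥ q) := by
        simpa using hH1.posSemidef.dotProduct_mulVec_nonneg q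
      calc ∑ τ ∈ S (T + 1), q ⬝ᵥ (H τ *ᵥ q) ≤ ∑ τ ∈ S (T + 1), N ^ 7 * (q ⬝ᵥ (H 1 *ᵥ q)) :=
            Finset.sum_le_sum fun τ hτ => hcmp τ (f2 hτ) q
        _ = (S (T + 1)).card * (N ^ 7 * (q ⬝ᵥ (H 1 *ᵥ q))) := by simp
        _ ≤ N ^ 2 * (N ^ 7 * (q ⬝ᵥ (H 1 *ᵥ q))) := by
          gcongr
          have : ((S (T + 1)).card : ℝ) ≤ T + 1 := by exact_mod_cast hcardT
          nlinarith
        _ = N ^ 9 • (q ⬝ᵥ (H 1 *ᵥ q)) := by rw [smul_eq_mul]; ring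
  have hdet := det_mono _ _ hApd hpsd
  rw [add_sub_cancel, Matrix.det_smul, Fintype.card_fin] at hdet
  have hpow : (2:ℝ) ^ n ≤ (N ^ 9) ^ (d + 1) :=
    le_of_mul_le_mul_right (f4.trans hdet) hH1.det_pos
  have hlog2 : 0 < Real.log 2 := Real.log_pos (by norm_num)
  have hL : (n:ℝ) * Real.log 2 ≤ 18 * d * Real.log N := by
    have := Real.log_le_log (by positivity) hpow
    rw [Real.log_pow, Real.log_pow, Real.log_pow] at this
    push_cast at this
    nlinarith
  have hn100 : (n:ℝ) ≤ 100 * d * Real.logb 2 N := by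
    rw [Real.logb, mul_div_assoc', le_div_iff₀ hlog2]
    have : 0 < d * Real.log N := by positivity
    linarith
  refine ⟨hn100, fun t ht => ⟨?_, ?_⟩⟩
  · obtain ⟨ht1, ht2⟩ := Finset.mem_Icc.1 ht
    obtain ⟨k, rfl⟩ : ∃ k, t = k + 1 := ⟨t - 1, by omega⟩
    obtain ⟨-, -, i3, -⟩ := inv k (by omega)
    rw [i3]
    gcongr
    rw [hn]
    have := Finset.card_le_card (hmono (T + 1) (by omega) le_rfl (k + 1) ht1 (by omega))
    omega
  · gcongr
    rw [hκ, ← Real.exp_nat_mul, ← hN]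
    refine le_trans (Real.exp_le_exp.2 ?_) exp_inv_log_two_le
    rw [mul_one_div, div_le_div_iff₀ (by positivity) hlog2]
    have : 0 < d * Real.log N := by positivity
    linarith
end
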